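/- arXiv:1412.5098 — 4 statements merged into one kernel-verified Lean document; each statement's English description precedes it below -/
import Mathlib

section
/- Let $\mathfrak{g} = \mathfrak{g}_{\bar 0} \oplus \mathfrak{g}_{\bar 1}$ be a finite-dimensional solvable Lie superalgebra over $\mathbb{C}$ satisfying $[\mathfrak{g}_{\bar 1}, \mathfrak{g}_{\bar 1}] \subseteq [\mathfrak{g}_{\bar 0}, \mathfrak{g}_{\bar 0}]$. Then every irreducible finite-dimensional $\mathfrak{g}$-module is one-dimensional. -/
/-- A complex Lie superalgebra structure on a `ℂ`-vector space `L`: a `ℤ₂`-grading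
`L = g₀ ⊕ g₁` together with a bilinear bracket respecting the grading and satisfying
the super-skew-symmetry and super Jacobi identities (written case by case according
to parities; the case of an even first argument covers all signs `+1`). -/
structure LieSuper (L : Type*) [AddCommGroup L] [Module ℂ L] where
  g0 : Submodule ℂ L
  g1 : Submodule ℂ L
  compl : IsCompl g0 g1
  br : L →ₗ[ℂ] L →ₗ[ℂ] L
  map00 : ∀ x ∈ g0, ∀ y ∈ g0, br x y ∈ g0
  map01 : ∀ x ∈ g0, ∀ y ∈ g1, br x y ∈ g1
  map10 : ∀ x ∈ g1, ∀ y ∈ g0, br x y ∈ g1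
  map11 : ∀ x ∈ g1, ∀ y ∈ g1, br x y ∈ g0
  skew_e : ∀ x ∈ g0, ∀ y : L, br x y = - br y x
  skew_oo : ∀ x ∈ g1, ∀ y ∈ g1, br x y = br y x
  jacobi_e : ∀ x ∈ g0, ∀ y z : L, br x (br y z) = br (br x y) z + br y (br x z)
  jacobi_oe : ∀ x ∈ g1, ∀ y ∈ g0, ∀ z : L, br x (br y z) = br (br x y) z + br y (br x z)
  jacobi_oo : ∀ x ∈ g1, ∀ y ∈ g1, ∀ z : L, br x (br y z) = br (br x y) z - br y (br x z)

variable {L : Type*} [AddCommGroup L] [Module ℂ L]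

/-- The derived series of a Lie superalgebra. -/
def LieSuper.derived (S : LieSuper L) : ℕ → Submodule ℂ L
  | 0 => ⊤
  | k + 1 => Submodule.span ℂ
      {z | ∃ x ∈ S.derived k, ∃ y ∈ S.derived k, z = S.br x y}

/-- A Lie superalgebra is solvable if its derived series terminates at zero. -/
def LieSuper.Solvable (S : LieSuper L) : Prop := ∃ k, S.derived k = ⊥

/-- A representation of the Lie superalgebra `S` on a `ℤ₂`-graded complex vector space
`M`.  The grading of `M` is recorded by its parity involution `P` (`+1` on the even
part, `-1` on the odd part); `P` commutes with the action of even elements and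
anticommutes with the action of odd elements, and the bracket acts by the
supercommutator. -/
structure SuperRep (S : LieSuper L) (M : Type*) [AddCommGroup M] [Module ℂ M] where
  act : L →ₗ[ℂ] M →ₗ[ℂ] M
  P : M →ₗ[ℂ] M
  P_sq : P ∘ₗ P = LinearMap.id
  P_act_e : ∀ x ∈ S.g0, P ∘ₗ act x = act x ∘ₗ P
  P_act_o : ∀ x ∈ S.g1, P ∘ₗ act x = - (act x ∘ₗ P)
  act_br_e : ∀ x ∈ S.g0, ∀ y : L,
    act (S.br x y) = act x ∘ₗ act y - act y ∘ₗ act x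
  act_br_oe : ∀ x ∈ S.g1, ∀ y ∈ S.g0,
    act (S.br x y) = act x ∘ₗ act y - act y ∘ₗ act x
  act_br_oo : ∀ x ∈ S.g1, ∀ y ∈ S.g1,
    act (S.br x y) = act x ∘ₗ act y + act y ∘ₗ act x

variable {S : LieSuper L} {M : Type*} [AddCommGroup M] [Module ℂ M]

/-- A (graded) submodule of a super representation: a subspace stable under the action
and under the parity involution (stability under `P` is the homogeneity condition). -/
def SuperRep.Invt (ρ : SuperRep S M) (N : Submodule ℂ M) : Prop :=
  (∀ x : L, ∀ m ∈ N, ρ.act x m ∈ N) ∧ ∀ m ∈ N, ρ.P m ∈ N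

/-- Irreducibility of a super representation: `M ≠ 0` and the only graded invariant
subspaces are `0` and `M`. -/
def SuperRep.Irred (ρ : SuperRep S M) : Prop :=
  Nontrivial M ∧ ∀ N : Submodule ℂ M, ρ.Invt N → N = ⊥ ∨ N = ⊤

theorem self_eq_neg_iff_zero {V : Type*} [AddCommGroup V] [Module ℂ V] (v : V) :
    v = -v ↔ v = 0 := by
  have : IsAddTorsionFree V := .of_isTorsionFree ℂ V
  exact self_eq_neg

/-- The even part is a Lie ring. -/
@[reducible] def LieSuper.evenLieRing (S : LieSuper L) : LieRing S.g0 where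
  bracket x y := ⟨S.br x y, S.map00 _ x.2 _ y.2⟩
  add_lie x y z := Subtype.ext (by change S.br _ _ = S.br _ _ + S.br _ _; simp)
  lie_add x y z := Subtype.ext (by change S.br _ _ = S.br _ _ + S.br _ _; simp)
  lie_self x := Subtype.ext (by
    change S.br x x = 0
    exact (self_eq_neg_iff_zero _).1 (S.skew_e _ x.2 x))
  leibniz_lie x y z := Subtype.ext (S.jacobi_e _ x.2 _ _)

/-- The even part is a Lie algebra. -/
@[reducible] def LieSuper.evenLieAlgebra (S : LieSuper L) :
    letI := S.evenLieRing
    LieAlgebra ℂ S.g0 :=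
  letI := S.evenLieRing
  { lie_smul := fun t x y => Subtype.ext (by change S.br _ _ = t • S.br _ _; simp) }

theorem LieSuper.even_solvable (S : LieSuper L) (h : S.Solvable) :
    letI := S.evenLieRing
    letI := S.evenLieAlgebra
    LieAlgebra.IsSolvable S.g0 := by
  letI := S.evenLieRing
  letI := S.evenLieAlgebra
  obtain ⟨k, hk⟩ := h
  have key : ∀ n, ∀ x ∈ LieAlgebra.derivedSeries ℂ S.g0 n, (x : L) ∈ S.derived n := by
    intro n
    induction n with
    | zero => intro x _; exact Submodule.mem_top
    | succ n ih =>
      intro x hx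
      rw [LieAlgebra.derivedSeries_def, LieAlgebra.derivedSeriesOfIdeal_succ,
        ← LieSubmodule.mem_toSubmodule, LieSubmodule.lieIdeal_oper_eq_linear_span] at hx
      have : Submodule.span ℂ {m : S.g0 | ∃ x : LieAlgebra.derivedSeries ℂ S.g0 n,
          ∃ y : LieAlgebra.derivedSeries ℂ S.g0 n, ⁅(x : S.g0), (y : S.g0)⁆ = m} ≤
          (S.derived (n+1)).comap S.g0.subtype := by
        rw [Submodule.span_le]
        rintro _ ⟨x, y, rfl⟩
        exact Submodule.subset_span ⟨_, ih _ x.2, _, ih _ y.2, rfl⟩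
      exact this hx
  rw [LieAlgebra.isSolvable_iff ℂ]
  refine ⟨k, ?_⟩
  rw [eq_bot_iff]
  intro x hx
  have := key k x hx
  rw [hk] at this
  exact (LieSubmodule.mem_bot _).2 (Subtype.ext ((Submodule.mem_bot ℂ).1 this))

theorem LieSuper.lie_thm [FiniteDimensional ℂ L] (S : LieSuper L) (h : S.Solvable)
    {V : Type*} [AddCommGroup V] [Module ℂ V] [FiniteDimensional ℂ V] [Nontrivial V]
    (φ : S.g0 →ₗ[ℂ] V →ₗ[ℂ] V)
    (hφ : ∀ x y : S.g0, φ ⟨S.br x y, S.map00 _ x.2 _ y.2⟩ = φ x ∘ₗ φ y - φ y ∘ₗ φ x) :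
    ∃ v : V, v ≠ 0 ∧ ∀ x : S.g0, ∃ c : ℂ, φ x v = c • v := by
  letI := S.evenLieRing
  letI := S.evenLieAlgebra
  haveI := S.even_solvable h
  letI : LieRingModule S.g0 V :=
    { bracket := fun x v => φ x v
      add_lie := fun x y v => by change φ _ _ = φ _ _ + φ _ _; simp
      lie_add := fun x v w => by change φ _ _ = φ _ _ + φ _ _; simp
      leibniz_lie := fun x y v => by
        change φ x (φ y v) = φ ⟨S.br x y, S.map00 _ x.2 _ y.2⟩ v + φ y (φ x v)
        rw [hφ]; simp }
  letI : LieModule ℂ S.g0 V :=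
    { smul_lie := fun t x v => by change φ _ _ = t • φ _ _; simp
      lie_smul := fun t x v => by change φ _ _ = t • φ _ _; simp }
  obtain ⟨χ, hχ⟩ := LieModule.exists_nontrivial_weightSpace_of_isSolvable ℂ S.g0 V
  obtain ⟨⟨v, hv⟩, hv0⟩ := exists_ne (0 : LieModule.weightSpace V χ)
  rw [LieModule.mem_weightSpace] at hv
  refine ⟨v, fun h0 => hv0 (Subtype.ext h0), fun x => ⟨χ x, hv x⟩⟩

/-- The span of brackets of even elements. -/
abbrev LieSuper.A (S : LieSuper L) : Submodule ℂ L :=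
  Submodule.span ℂ {z | ∃ x ∈ S.g0, ∃ y ∈ S.g0, z = S.br x y}

theorem LieSuper.A_le (S : LieSuper L) : S.A ≤ S.g0 := by
  rw [Submodule.span_le]
  rintro _ ⟨x, hx, y, hy, rfl⟩
  exact S.map00 _ hx _ hy

theorem SuperRep.exists_killed [FiniteDimensional ℂ L] [FiniteDimensional ℂ M]
    (S : LieSuper L) (hsolv : S.Solvable)
    (hodd : ∀ x ∈ S.g1, ∀ y ∈ S.g1, S.br x y ∈ S.A)
    (ρ : SuperRep S M) [Nontrivial M] :
    ∃ v : M, v ≠ 0 ∧ (∀ a ∈ S.A, ρ.act a v = 0) ∧ ∀ y ∈ S.g1, ρ.act y v = 0 := by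
  let T : Set (Submodule ℂ L) := {W | S.g0 ≤ W ∧ (∀ a ∈ S.g0, ∀ w ∈ W, S.br a w ∈ W) ∧
    ∃ v : M, v ≠ 0 ∧ (∀ a ∈ S.A, ρ.act a v = 0) ∧ ∀ y ∈ S.g1, y ∈ W → ρ.act y v = 0}
  have hT : T.Nonempty := by
    refine ⟨S.g0, le_rfl, S.map00, ?_⟩
    obtain ⟨v, hv0, hv⟩ := S.lie_thm hsolv (ρ.act ∘ₗ S.g0.subtype)
      (fun x y => ρ.act_br_e _ x.2 _)
    refine ⟨v, hv0, ?_, ?_⟩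
    · have : S.A ≤ LinearMap.ker (ρ.act.flip v) := by
        rw [Submodule.span_le]
        rintro _ ⟨x, hx, y, hy, rfl⟩
        obtain ⟨c, hc⟩ := hv ⟨x, hx⟩
        obtain ⟨d, hd⟩ := hv ⟨y, hy⟩
        simp only [LinearMap.comp_apply, Submodule.subtype_apply] at hc hd
        simp [ρ.act_br_e x hx, hc, hd, smul_smul, mul_comm c d]
      exact fun a ha => this ha
    · intro y h1 h0
      have : y = 0 := by
        have := S.compl.disjoint.le_bot (Submodule.mem_inf.2 ⟨h0, h1⟩)
        simpa using this
      simp [this]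
  obtain ⟨W, ⟨hW0, hWst, v, hv0, hvA, hv1⟩, hmax⟩ :=
    (wellFounded_gt (α := Submodule ℂ L)).has_min T hT
  by_cases htop : W = ⊤
  · subst htop
    exact ⟨v, hv0, hvA, fun y hy => hv1 y hy Submodule.mem_top⟩
  exfalso
  haveI : Nontrivial (L ⧸ W) := Submodule.Quotient.nontrivial_iff.2 htop
  -- weight vector in the quotient
  let φ : S.g0 →ₗ[ℂ] (L ⧸ W) →ₗ[ℂ] (L ⧸ W) :=
    { toFun := fun x => W.mapQ W (S.br x) (fun w hw => hWst _ x.2 _ hw)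
      map_add' := fun x y => by
        apply Submodule.linearMap_qext; ext z; simp
      map_smul' := fun c x => by
        apply Submodule.linearMap_qext; ext z; simp }
  obtain ⟨q, hq0, hq⟩ := S.lie_thm hsolv φ (fun x y => by
    apply Submodule.linearMap_qext
    ext z
    have h := S.jacobi_e _ x.2 y z
    simp [φ, h])
  obtain ⟨x', rfl⟩ := Submodule.Quotient.mk_surjective W q
  obtain ⟨x0, hx0, x, hx, hxx⟩ : ∃ x0 ∈ S.g0, ∃ x ∈ S.g1, x0 + x = x' :=
    Submodule.mem_sup.1 (by rw [S.compl.sup_eq_top]; exact Submodule.mem_top)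
  have hmk : (Submodule.Quotient.mk x' : L ⧸ W) = Submodule.Quotient.mk x := by
    rw [Submodule.Quotient.eq]
    have : x' - x = x0 := by rw [← hxx]; abel
    rw [this]; exact hW0 hx0
  rw [hmk] at hq0 hq
  have hxW : x ∉ W := fun h => hq0 ((Submodule.Quotient.mk_eq_zero W).2 h)
  have hwt : ∀ a ∈ S.g0, ∃ c : ℂ, S.br a x - c • x ∈ W := by
    intro a ha
    obtain ⟨c, hc⟩ := hq ⟨a, ha⟩
    refine ⟨c, (Submodule.Quotient.eq W).1 ?_⟩
    simpa [φ] using hc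
  have hAx : ∀ a ∈ S.A, S.br a x ∈ W := by
    have : S.A ≤ W.comap (S.br.flip x) := by
      rw [Submodule.span_le]
      rintro _ ⟨p, hp, q, hq, rfl⟩
      obtain ⟨c, hc⟩ := hwt p hp
      obtain ⟨d, hd⟩ := hwt q hq
      have e : S.br (S.br p q) x = (S.br p (S.br q x - d • x) + d • (S.br p x - c • x))
          - (S.br q (S.br p x - c • x) + c • (S.br q x - d • x)) := by
        rw [eq_sub_of_add_eq (S.jacobi_e p hp q x).symm]
        simp only [map_sub, map_smul, smul_sub, smul_smul, mul_comm c d]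
        abel
      change S.br (S.br p q) x ∈ W
      rw [e]
      exact W.sub_mem (W.add_mem (hWst _ hp _ hd) (W.smul_mem _ hc))
        (W.add_mem (hWst _ hq _ hc) (W.smul_mem _ hd))
    exact fun a ha => this ha
  -- the vector killed by x as well
  obtain ⟨u, hu0, huA, hu1, hux⟩ : ∃ u : M, u ≠ 0 ∧ (∀ a ∈ S.A, ρ.act a u = 0) ∧
      (∀ y ∈ S.g1, y ∈ W → ρ.act y u = 0) ∧ ρ.act x u = 0 := by
    by_cases hxv : ρ.act x v = 0
    · exact ⟨v, hv0, hvA, hv1, hxv⟩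
    refine ⟨ρ.act x v, hxv, ?_, ?_, ?_⟩
    · intro a ha
      have h := LinearMap.congr_fun (ρ.act_br_e a (S.A_le ha) x) v
      simp only [LinearMap.sub_apply, LinearMap.comp_apply, hvA a ha, map_zero, sub_zero] at h
      rw [← h]
      exact hv1 _ (S.map01 _ (S.A_le ha) _ hx) (hAx a ha)
    · intro y hy hyW
      have h := LinearMap.congr_fun (ρ.act_br_oo y hy x hx) v
      simp only [LinearMap.add_apply, LinearMap.comp_apply, hv1 y hy hyW, map_zero, add_zero] at h
      rw [← h]
      exact hvA _ (hodd _ hy _ hx)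
    · have h := LinearMap.congr_fun (ρ.act_br_oo x hx x hx) v
      simp only [LinearMap.add_apply, LinearMap.comp_apply, hvA _ (hodd _ hx _ hx)] at h
      exact (self_eq_neg_iff_zero _).1 (eq_neg_of_add_eq_zero_left h.symm)
  refine hmax (W ⊔ Submodule.span ℂ {x}) ⟨hW0.trans le_sup_left, ?_, u, hu0, huA, ?_⟩ ?_
  · intro a ha w' hw'
    obtain ⟨w, hw, t, ht, rfl⟩ := Submodule.mem_sup.1 hw'
    obtain ⟨t, rfl⟩ := Submodule.mem_span_singleton.1 ht
    obtain ⟨c, hc⟩ := hwt a ha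
    have e : S.br a (w + t • x) = (S.br a w + t • (S.br a x - c • x)) + (t * c) • x := by
      simp only [map_add, map_smul, smul_sub, smul_smul]; abel
    rw [e]
    exact Submodule.add_mem_sup (W.add_mem (hWst _ ha _ hw) (W.smul_mem _ hc))
      (Submodule.smul_mem _ _ (Submodule.mem_span_singleton_self x))
  · intro y hy hyW
    obtain ⟨w, hw, t, ht, rfl⟩ := Submodule.mem_sup.1 hyW
    obtain ⟨t, rfl⟩ := Submodule.mem_span_singleton.1 ht
    have hw1 : w ∈ S.g1 := (Submodule.add_mem_iff_left _ (S.g1.smul_mem t hx)).1 hy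
    simp [hu1 w hw1 hw, hux]
  · refine lt_of_le_of_ne le_sup_left fun h => hxW ?_
    rw [h]
    exact Submodule.mem_sup_right (Submodule.mem_span_singleton_self x)

/-- Every irreducible finite-dimensional module over a finite-dimensional solvable
complex Lie superalgebra `𝔤` with `[𝔤₁, 𝔤₁] ⊆ [𝔤₀, 𝔤₀]` is one-dimensional. -/
theorem solvable_irred_one_dimensional
    [FiniteDimensional ℂ L] [FiniteDimensional ℂ M]
    (S : LieSuper L) (hsolv : S.Solvable)
    (hodd : Submodule.span ℂ {z | ∃ x ∈ S.g1, ∃ y ∈ S.g1, z = S.br x y} ≤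
      Submodule.span ℂ {z | ∃ x ∈ S.g0, ∃ y ∈ S.g0, z = S.br x y})
    (ρ : SuperRep S M) (hirr : ρ.Irred) :
    Module.finrank ℂ M = 1 := by
  obtain ⟨hM, hirr⟩ := hirr
  have dec : ∀ x : L, ∃ x0 ∈ S.g0, ∃ x1 ∈ S.g1, x0 + x1 = x := fun x =>
    Submodule.mem_sup.1 (by rw [S.compl.sup_eq_top]; exact Submodule.mem_top)
  obtain ⟨v, hv0, hvA, hv1⟩ := SuperRep.exists_killed S hsolv
    (fun x hx y hy => hodd (Submodule.subset_span ⟨x, hx, y, hy, rfl⟩)) ρ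
  let N : Submodule ℂ M :=
    { carrier := {v | (∀ a ∈ S.A, ρ.act a v = 0) ∧ ∀ y ∈ S.g1, ρ.act y v = 0}
      zero_mem' := ⟨fun a _ => map_zero _, fun a _ => map_zero _⟩
      add_mem' := fun {v w} hv hw =>
        ⟨fun a ha => by rw [map_add, hv.1 a ha, hw.1 a ha, add_zero],
         fun a ha => by rw [map_add, hv.2 a ha, hw.2 a ha, add_zero]⟩
      smul_mem' := fun c v hv =>
        ⟨fun a ha => by rw [map_smul, hv.1 a ha, smul_zero],
         fun a ha => by rw [map_smul, hv.2 a ha, smul_zero]⟩ }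
  have hN : ρ.Invt N := by
    constructor
    · intro x m hm
      obtain ⟨x0, h0, x1, h1, rfl⟩ := dec x
      rw [map_add, LinearMap.add_apply, hm.2 x1 h1, add_zero]
      constructor
      · intro a ha
        have h := LinearMap.congr_fun (ρ.act_br_e a (S.A_le ha) x0) m
        rw [hm.1 _ (Submodule.subset_span ⟨a, S.A_le ha, x0, h0, rfl⟩)] at h
        simpa [hm.1 a ha] using h.symm
      · intro y hy
        have h := LinearMap.congr_fun (ρ.act_br_oe y hy x0 h0) m
        rw [hm.2 _ (S.map10 _ hy _ h0)] at h
        simpa [hm.2 y hy] using h.symm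
    · intro m hm
      constructor
      · intro a ha
        have h := LinearMap.congr_fun (ρ.P_act_e a (S.A_le ha)) m
        simpa [hm.1 a ha] using h.symm
      · intro y hy
        have h := LinearMap.congr_fun (ρ.P_act_o y hy) m
        simpa [hm.2 y hy] using h.symm
  have hNtop : N = ⊤ := by
    refine (hirr N hN).resolve_left fun hb => hv0 ?_
    have : v ∈ N := ⟨hvA, hv1⟩
    rw [hb] at this
    simpa using this
  have hkill : ∀ y ∈ S.g1, ∀ m, ρ.act y m = 0 := fun y hy m => by
    have : m ∈ N := by rw [hNtop]; exact Submodule.mem_top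
    exact this.2 y hy
  obtain ⟨w, hw0, hw⟩ := S.lie_thm hsolv (ρ.act ∘ₗ S.g0.subtype)
      (fun x y => ρ.act_br_e _ x.2 _)
  have hPP : ∀ m, ρ.P (ρ.P m) = m := fun m => LinearMap.congr_fun ρ.P_sq m
  obtain ⟨u, hu0, ⟨d, hd⟩, hu⟩ : ∃ u : M, u ≠ 0 ∧ (∃ d : ℂ, ρ.P u = d • u) ∧
      ∀ x ∈ S.g0, ∃ c : ℂ, ρ.act x u = c • u := by
    have hPw : ∀ x ∈ S.g0, ∃ c : ℂ, ρ.act x w = c • w ∧ ρ.act x (ρ.P w) = c • ρ.P w := by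
      intro x hx
      obtain ⟨c, hc⟩ := hw ⟨x, hx⟩
      simp only [LinearMap.comp_apply, Submodule.subtype_apply] at hc
      refine ⟨c, hc, ?_⟩
      have h := LinearMap.congr_fun (ρ.P_act_e x hx) w
      simp only [LinearMap.comp_apply, hc, map_smul] at h
      exact h.symm
    by_cases hz : w + ρ.P w = 0
    · refine ⟨w, hw0, ⟨-1, ?_⟩, fun x hx => ?_⟩
      · rw [neg_one_smul]; exact eq_neg_of_add_eq_zero_right hz
      · obtain ⟨c, hc, _⟩ := hPw x hx
        exact ⟨c, hc⟩
    · refine ⟨w + ρ.P w, hz, ⟨1, ?_⟩, fun x hx => ?_⟩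
      · rw [map_add, hPP, one_smul, add_comm]
      · obtain ⟨c, hc, hc'⟩ := hPw x hx
        exact ⟨c, by rw [map_add, hc, hc', smul_add]⟩
  have hI : ρ.Invt (Submodule.span ℂ {u}) := by
    constructor
    · intro x m hm
      obtain ⟨t, rfl⟩ := Submodule.mem_span_singleton.1 hm
      obtain ⟨x0, h0, x1, h1, rfl⟩ := dec x
      obtain ⟨c, hc⟩ := hu x0 h0
      rw [map_add, LinearMap.add_apply, hkill x1 h1, add_zero, map_smul, hc]
      exact Submodule.smul_mem _ _ (Submodule.smul_mem _ _ (Submodule.mem_span_singleton_self u))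
    · intro m hm
      obtain ⟨t, rfl⟩ := Submodule.mem_span_singleton.1 hm
      rw [map_smul, hd]
      exact Submodule.smul_mem _ _ (Submodule.smul_mem _ _ (Submodule.mem_span_singleton_self u))
  rcases hirr _ hI with h | h
  · exact absurd (Submodule.span_singleton_eq_bot.1 h) hu0
  · rw [← finrank_top ℂ M, ← h, finrank_span_singleton hu0]
end

section
/- Let $\mathfrak{h}$ be the standard Cartan subalgebra of $\mathfrak{q}(n)$, $n \geq 2$, and $A$ a commutative unital $\mathbb{C}$-algebra. An irreducible $\mathfrak{h} \otimes A$-module $V$ is finite-dimensional if and only if there exists a finite-codimensional ideal $I$ of $A$ such that $(\mathfrak{h} \otimes I)V = 0$. -/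
open Matrix

noncomputable section

variable (n : ℕ) (A : Type*) [CommRing A] [Algebra ℂ A]

/-- Square matrices of size `n+1` with entries in the commutative `ℂ`-algebra `A`. -/
abbrev QMat := Matrix (Fin (n + 1)) (Fin (n + 1)) A

/-- The ambient space of pairs `(X, Y)` of matrices over `A`; a pair represents the
element of `𝔮(n) ⊗ A` with even component `X` and odd component `Y` (using the
identification of `𝔮(n) ⊗ A` with pairs of traceless `(n+1) × (n+1)` matrices over
`A`, where `(X, Y)` corresponds to the class of `[[X, Y], [Y, X]]`). -/
abbrev QPair := QMat n A × QMat n A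

/-- `𝔮(n) ⊗ A`, realized as the space of pairs of traceless matrices over `A`. -/
def qA : Submodule ℂ (QPair n A) where
  carrier := {p | p.1.trace = 0 ∧ p.2.trace = 0}
  add_mem' := by
    intro p q hp hq
    exact ⟨by simp [hp.1, hq.1], by simp [hp.2, hq.2]⟩
  zero_mem' := by simp
  smul_mem' := by
    intro c p hp
    exact ⟨by simp [hp.1], by simp [hp.2]⟩

/-- The Lie superbracket of `𝔮(n) ⊗ A` in the matrix-pair model: on even components it
is the commutator plus the anticommutator of the odd components (projected back to
traceless matrices), and on odd components it is given by the mixed commutators. -/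
def qbr (p q : QPair n A) : QPair n A :=
  (p.1 * q.1 - q.1 * p.1 + p.2 * q.2 + q.2 * p.2 -
      (((n : ℂ) + 1)⁻¹ • (p.2 * q.2 + q.2 * p.2).trace) • (1 : QMat n A),
    p.1 * q.2 - q.2 * p.1 + p.2 * q.1 - q.1 * p.2)

lemma qbr_mem (p q : QPair n A) : qbr n A p q ∈ qA n A := by
  have h1 : ((((n : ℂ) + 1)⁻¹ • (p.2 * q.2 + q.2 * p.2).trace) •
      (1 : QMat n A)).trace = (p.2 * q.2 + q.2 * p.2).trace := by
    rw [Matrix.trace_smul, Matrix.trace_one, smul_eq_mul, smul_mul_assoc]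
    rw [show ((Fintype.card (Fin (n + 1)) : A)) = ((n + 1 : ℕ) : A) by simp]
    rw [← nsmul_eq_mul', ← Nat.cast_smul_eq_nsmul ℂ, smul_smul]
    rw [show (((n + 1 : ℕ) : ℂ)) = (n : ℂ) + 1 by push_cast; ring]
    rw [inv_mul_cancel₀ (by
      exact_mod_cast Nat.cast_add_one_ne_zero (R := ℂ) n), one_smul]
  constructor
  · show (p.1 * q.1 - q.1 * p.1 + p.2 * q.2 + q.2 * p.2 -
      (((n : ℂ) + 1)⁻¹ • (p.2 * q.2 + q.2 * p.2).trace) • (1 : QMat n A)).trace = 0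
    rw [Matrix.trace_sub, h1, Matrix.trace_add, Matrix.trace_add, Matrix.trace_sub,
      Matrix.trace_add, Matrix.trace_mul_comm p.1 q.1]
    ring
  · show (p.1 * q.2 - q.2 * p.1 + p.2 * q.1 - q.1 * p.2).trace = 0
    rw [Matrix.trace_sub, Matrix.trace_add, Matrix.trace_sub,
      Matrix.trace_mul_comm p.1 q.2, Matrix.trace_mul_comm p.2 q.1]
    ring

/-- An element of the matrix-pair model is even if its odd component vanishes. -/
def IsEvenElt (p : QPair n A) : Prop := p.2 = 0

/-- An element of the matrix-pair model is odd if its even component vanishes. -/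
def IsOddElt (p : QPair n A) : Prop := p.1 = 0

/-- Membership in `𝔥₀ ⊗ A`: even, with diagonal matrix component. -/
def InH0 (p : QPair n A) : Prop := p.2 = 0 ∧ p.1.IsDiag

/-- Membership in `𝔥₁ ⊗ A`: odd, with diagonal matrix component. -/
def InH1 (p : QPair n A) : Prop := p.1 = 0 ∧ p.2.IsDiag

/-- Membership in `𝔥 ⊗ A`: both components diagonal. -/
def InH (p : QPair n A) : Prop := p.1.IsDiag ∧ p.2.IsDiag

/-- Membership in `𝔫⁺ ⊗ A`: both components strictly upper triangular. -/
def InNplus (p : QPair n A) : Prop :=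
  ∀ i j : Fin (n + 1), j ≤ i → p.1 i j = 0 ∧ p.2 i j = 0

/-- Membership in `𝔮(n) ⊗ I` for an ideal `I ⊆ A`: all entries lie in `I`. -/
def EntriesIn (I : Ideal A) (p : QPair n A) : Prop :=
  ∀ i j : Fin (n + 1), p.1 i j ∈ I ∧ p.2 i j ∈ I

/-- `𝔥₀ ⊗ A` as a subspace of the matrix-pair model of `𝔮(n) ⊗ A`: even diagonal
traceless pairs. -/
def h0A : Submodule ℂ (QPair n A) where
  carrier := {p | p.2 = 0 ∧ p.1.IsDiag ∧ p.1.trace = 0}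
  add_mem' := by
    intro p q hp hq
    exact ⟨by simp [hp.1, hq.1], hp.2.1.add hq.2.1, by simp [hp.2.2, hq.2.2]⟩
  zero_mem' := ⟨rfl, Matrix.isDiag_zero, by simp⟩
  smul_mem' := by
    intro c p hp
    exact ⟨by simp [hp.1], hp.2.1.smul c, by simp [hp.2.2]⟩

lemma h0A_le_qA : h0A n A ≤ qA n A := by
  intro p hp
  exact ⟨hp.2.2, by simp [hp.1]⟩

/-- The raw data of an action of `𝔮(n) ⊗ A` on a `ℤ₂`-graded vector space `M`: an
action map and the parity involution `P` of `M`. -/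
structure QAct (M : Type*) [AddCommGroup M] [Module ℂ M] where
  act : ↥(qA n A) →ₗ[ℂ] M →ₗ[ℂ] M
  P : M →ₗ[ℂ] M

variable {M : Type*} [AddCommGroup M] [Module ℂ M]

/-- The data `ρ` is a representation of the Lie superalgebra `𝔮(n) ⊗ A`: `P` is an
involution, commuting (resp. anticommuting) with the action of even (resp. odd)
elements, and the bracket acts by the supercommutator. -/
def QAct.IsRep (ρ : QAct n A M) : Prop :=
  (ρ.P ∘ₗ ρ.P = LinearMap.id) ∧
  (∀ x : ↥(qA n A), IsEvenElt n A ↑x → ρ.P ∘ₗ ρ.act x = ρ.act x ∘ₗ ρ.P) ∧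
  (∀ x : ↥(qA n A), IsOddElt n A ↑x → ρ.P ∘ₗ ρ.act x = -(ρ.act x ∘ₗ ρ.P)) ∧
  (∀ x y : ↥(qA n A), (IsEvenElt n A ↑x ∨ IsEvenElt n A ↑y) →
    ρ.act ⟨qbr n A ↑x ↑y, qbr_mem n A _ _⟩ = ρ.act x ∘ₗ ρ.act y - ρ.act y ∘ₗ ρ.act x) ∧
  (∀ x y : ↥(qA n A), IsOddElt n A ↑x → IsOddElt n A ↑y →
    ρ.act ⟨qbr n A ↑x ↑y, qbr_mem n A _ _⟩ = ρ.act x ∘ₗ ρ.act y + ρ.act y ∘ₗ ρ.act x)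

/-- A graded submodule: stable under the action and under the parity involution. -/
def QAct.Invt (ρ : QAct n A M) (N : Submodule ℂ M) : Prop :=
  (∀ x : ↥(qA n A), ∀ m ∈ N, ρ.act x m ∈ N) ∧ ∀ m ∈ N, ρ.P m ∈ N

/-- Irreducibility: `M ≠ 0` and the only graded invariant subspaces are `0`, `M`. -/
def QAct.Irred (ρ : QAct n A M) : Prop :=
  Nontrivial M ∧ ∀ N : Submodule ℂ M, QAct.Invt n A ρ N → N = ⊥ ∨ N = ⊤

/-- The `U(𝔮(n) ⊗ A)`-submodule of `M` generated by `v`: the smallest subspace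
containing `v` and stable under the action. -/
def QAct.gen (ρ : QAct n A M) (v : M) : Submodule ℂ M :=
  sInf {N | v ∈ N ∧ ∀ x : ↥(qA n A), ∀ m ∈ N, ρ.act x m ∈ N}

/-- `v` is a highest weight vector of `ρ` with highest weight `ψ : 𝔥₀ ⊗ A → ℂ`:
`v ≠ 0`, `v` generates `M` (i.e. `U(𝔮 ⊗ A)v = M`), `(𝔫⁺ ⊗ A)v = 0` and every element
of `𝔥₀ ⊗ A` acts on `v` by the scalar given by `ψ` (i.e. `U(𝔥₀ ⊗ A)v = ℂv`). -/
def QAct.IsHWVector (ρ : QAct n A M) (ψ : ↥(h0A n A) →ₗ[ℂ] ℂ) (v : M) : Prop :=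
  v ≠ 0 ∧ QAct.gen n A ρ v = ⊤ ∧
  (∀ x : ↥(qA n A), InNplus n A ↑x → ρ.act x v = 0) ∧
  (∀ (p : QPair n A) (hp : p ∈ h0A n A),
    ρ.act ⟨p, h0A_le_qA n A hp⟩ v = ψ ⟨p, hp⟩ • v)

/-- `ψ ∈ 𝓛(𝔥 ⊗ A)`: a functional on `𝔥₀ ⊗ A` vanishing on `𝔥₀ ⊗ I` for some
finite-codimensional ideal `I ⊆ A`. -/
def LFun (ψ : ↥(h0A n A) →ₗ[ℂ] ℂ) : Prop :=
  ∃ I : Ideal A, FiniteDimensional ℂ (A ⧸ I) ∧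
    ∀ x : ↥(h0A n A), EntriesIn n A I ↑x → ψ x = 0

lemma IsDiag.mul_isDiag {X Y : QMat n A} (hX : X.IsDiag) (hY : Y.IsDiag) :
    (X * Y).IsDiag := by
  intro i j hij
  rw [Matrix.mul_apply]
  apply Finset.sum_eq_zero
  intro k _
  by_cases hk : k = i
  · subst hk
    rw [hY hij, mul_zero]
  · rw [hX (Ne.symm hk), zero_mul]

/-- `𝔥 ⊗ A`, the Cartan subalgebra of `𝔮(n) ⊗ A` in the matrix-pair model: pairs of
traceless diagonal matrices over `A`. -/
def hA : Submodule ℂ (QPair n A) where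
  carrier := {p | p.1.IsDiag ∧ p.2.IsDiag ∧ p.1.trace = 0 ∧ p.2.trace = 0}
  add_mem' := by
    intro p q hp hq
    exact ⟨hp.1.add hq.1, hp.2.1.add hq.2.1, by simp [hp.2.2.1, hq.2.2.1],
      by simp [hp.2.2.2, hq.2.2.2]⟩
  zero_mem' := ⟨Matrix.isDiag_zero, Matrix.isDiag_zero, by simp, by simp⟩
  smul_mem' := by
    intro c p hp
    exact ⟨hp.1.smul c, hp.2.1.smul c, by simp [hp.2.2.1], by simp [hp.2.2.2]⟩

lemma hA_le_qA : hA n A ≤ qA n A := fun p hp => ⟨hp.2.2.1, hp.2.2.2⟩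

lemma hbr_mem {p q : QPair n A} (hp : p ∈ hA n A) (hq : q ∈ hA n A) :
    qbr n A p q ∈ hA n A := by
  have h := qbr_mem n A p q
  obtain ⟨hp1, hp2, -, -⟩ := hp
  obtain ⟨hq1, hq2, -, -⟩ := hq
  refine ⟨?_, ?_, h.1, h.2⟩
  · exact ((((IsDiag.mul_isDiag n A hp1 hq1).sub
      (IsDiag.mul_isDiag n A hq1 hp1)).add
      (IsDiag.mul_isDiag n A hp2 hq2)).add
      (IsDiag.mul_isDiag n A hq2 hp2)).sub (Matrix.isDiag_one.smul _)
  · exact (((IsDiag.mul_isDiag n A hp1 hq2).sub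
      (IsDiag.mul_isDiag n A hq2 hp1)).add
      (IsDiag.mul_isDiag n A hp2 hq1)).sub (IsDiag.mul_isDiag n A hq1 hp2)

lemma h0A_le_hA : h0A n A ≤ hA n A := by
  intro p hp
  exact ⟨hp.2.1, by simp [hp.1], hp.2.2, by simp [hp.1]⟩

/-- The raw data of an action of the Cartan subalgebra `𝔥 ⊗ A` on a `ℤ₂`-graded
vector space `M`: an action map and the parity involution of `M`. -/
structure HAct (M : Type*) [AddCommGroup M] [Module ℂ M] where
  act : ↥(hA n A) →ₗ[ℂ] M →ₗ[ℂ] M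
  P : M →ₗ[ℂ] M

variable {M : Type*} [AddCommGroup M] [Module ℂ M]

/-- The data `ρ` is a representation of the Lie superalgebra `𝔥 ⊗ A`. -/
def HAct.IsRep (ρ : HAct n A M) : Prop :=
  (ρ.P ∘ₗ ρ.P = LinearMap.id) ∧
  (∀ x : ↥(hA n A), IsEvenElt n A ↑x → ρ.P ∘ₗ ρ.act x = ρ.act x ∘ₗ ρ.P) ∧
  (∀ x : ↥(hA n A), IsOddElt n A ↑x → ρ.P ∘ₗ ρ.act x = -(ρ.act x ∘ₗ ρ.P)) ∧
  (∀ x y : ↥(hA n A), (IsEvenElt n A ↑x ∨ IsEvenElt n A ↑y) →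
    ρ.act ⟨qbr n A ↑x ↑y, hbr_mem n A x.2 y.2⟩ = ρ.act x ∘ₗ ρ.act y - ρ.act y ∘ₗ ρ.act x) ∧
  (∀ x y : ↥(hA n A), IsOddElt n A ↑x → IsOddElt n A ↑y →
    ρ.act ⟨qbr n A ↑x ↑y, hbr_mem n A x.2 y.2⟩ = ρ.act x ∘ₗ ρ.act y + ρ.act y ∘ₗ ρ.act x)

/-- A graded subspace of an `𝔥 ⊗ A`-module, stable under the action and parity. -/
def HAct.Invt (ρ : HAct n A M) (N : Submodule ℂ M) : Prop :=
  (∀ x : ↥(hA n A), ∀ m ∈ N, ρ.act x m ∈ N) ∧ ∀ m ∈ N, ρ.P m ∈ N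

/-- Irreducibility of an `𝔥 ⊗ A`-module. -/
def HAct.Irred (ρ : HAct n A M) : Prop :=
  Nontrivial M ∧ ∀ N : Submodule ℂ M, HAct.Invt n A ρ N → N = ⊥ ∨ N = ⊤

lemma aux_fd_of_field {R V : Type*} [CommRing R] [Algebra ℂ R] [Algebra.FiniteType ℂ R]
    [AddCommGroup V] [Module ℂ V] [Module R V] [IsScalarTower ℂ R V] [Nontrivial V]
    [Module.Finite R V] (hfaith : ∀ r : R, (∀ m : V, r • m = 0) → r = 0)
    (hdiv : ∀ r : R, r ≠ 0 → ∀ m : V, ∃ m' : V, r • m' = m) : FiniteDimensional ℂ V := by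
  have hnt : Nontrivial R := Module.nontrivial R V
  have hF : IsField R := by
    refine ⟨⟨0, 1, zero_ne_one⟩, mul_comm, ?_⟩
    intro a ha
    have hle : (⊤ : Submodule R V) ≤ Ideal.span {a} • (⊤ : Submodule R V) := by
      intro m _
      obtain ⟨m', hm'⟩ := hdiv a ha m
      rw [← hm']
      exact Submodule.smul_mem_smul (Ideal.mem_span_singleton_self a) trivial
    obtain ⟨r, hr1, hr2⟩ := Submodule.exists_sub_one_mem_and_smul_eq_zero_of_fg_of_le_smul
      (Ideal.span {a}) (⊤ : Submodule R V) Module.Finite.fg_top hle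
    have hr0 : r = 0 := hfaith r (fun m => hr2 m trivial)
    rw [hr0, zero_sub, Ideal.mem_span_singleton] at hr1
    obtain ⟨c, hc⟩ := hr1
    exact ⟨-c, by rw [mul_neg, ← hc, neg_neg]⟩
  let : Field R := hF.toField
  have h1 : Module.Finite ℂ R := finite_of_finite_type_of_isJacobsonRing ℂ R
  exact Module.Finite.trans R V

lemma aux_fg {R V : Type*} [CommRing R] [AddCommGroup V] [Module R V]
    (P : V →ₗ[R] V) (hP : ∀ m, P (P m) = m) (v : V) (F : Finset (V →ₗ[R] V))
    (hanti : ∀ Y ∈ F, ∀ m, P (Y m) = - Y (P m))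
    (hsq : ∀ Y ∈ F, ∃ r : R, ∀ m, Y (Y m) = r • m)
    (hcl : ∀ Y ∈ F, ∀ Y' ∈ F, ∃ r : R, ∀ m, Y (Y' m) + Y' (Y m) = r • m) :
    ∃ S : Submodule R V, S.FG ∧ v ∈ S ∧ (∀ m ∈ S, P m ∈ S) ∧ ∀ Y ∈ F, ∀ m ∈ S, Y m ∈ S := by
  classical
  induction F using Finset.induction_on with
  | empty =>
    refine ⟨Submodule.span R {v, P v}, Submodule.fg_span (Set.toFinite _),
      Submodule.subset_span (by simp), ?_, by simp⟩
    intro m hm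
    induction hm using Submodule.span_induction with
    | mem x hx =>
      rcases hx with rfl | hx
      · exact Submodule.subset_span (by simp)
      · rw [Set.mem_singleton_iff] at hx
        rw [hx, hP]
        exact Submodule.subset_span (by simp)
    | zero => simp
    | add x y _ _ hx hy => rw [map_add]; exact add_mem hx hy
    | smul r x _ hx => rw [map_smul]; exact Submodule.smul_mem _ _ hx
  | insert Y F hYF ih =>
    obtain ⟨S, hfg, hv, hPS, hYS⟩ := ih (fun Z hZ => hanti Z (Finset.mem_insert_of_mem hZ))
      (fun Z hZ => hsq Z (Finset.mem_insert_of_mem hZ))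
      (fun Z hZ Z' hZ' => hcl Z (Finset.mem_insert_of_mem hZ) Z' (Finset.mem_insert_of_mem hZ'))
    have hY := Finset.mem_insert_self Y F
    refine ⟨S ⊔ S.map Y, hfg.sup (hfg.map Y), Submodule.mem_sup_left hv, ?_, ?_⟩
    · intro m hm
      obtain ⟨s, hs, t, ⟨u, hu, rfl⟩, rfl⟩ := Submodule.mem_sup.1 hm
      rw [map_add, hanti Y hY]
      exact add_mem (Submodule.mem_sup_left (hPS s hs))
        (neg_mem (Submodule.mem_sup_right ⟨_, hPS u hu, rfl⟩))
    · intro Z hZ m hm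
      obtain ⟨s, hs, t, ⟨u, hu, rfl⟩, rfl⟩ := Submodule.mem_sup.1 hm
      rw [map_add]
      rcases Finset.mem_insert.1 hZ with rfl | hZF
      · obtain ⟨r, hr⟩ := hsq Z hZ
        rw [hr]
        exact add_mem (Submodule.mem_sup_right ⟨s, hs, rfl⟩)
          (Submodule.mem_sup_left (S.smul_mem _ hu))
      · obtain ⟨r, hr⟩ := hcl Z hZ Y hY
        have : Z (Y u) = r • u - Y (Z u) := by rw [← hr u]; abel
        rw [this]
        exact add_mem (Submodule.mem_sup_left (hYS Z hZF s hs))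
          (sub_mem (Submodule.mem_sup_left (S.smul_mem _ hu))
            (Submodule.mem_sup_right ⟨_, hYS Z hZF u hu, rfl⟩))

/-- Trace-zero tuples. -/
def auxT : Submodule ℂ (Fin (n + 1) → A) :=
  LinearMap.ker (∑ i, LinearMap.proj i : (Fin (n + 1) → A) →ₗ[ℂ] A)

lemma aux_mem_T (t : Fin (n + 1) → A) : t ∈ auxT n A ↔ ∑ i, t i = 0 := by
  simp [auxT, LinearMap.sum_apply]

/-- even diagonal element -/
def auxEv : ↥(auxT n A) →ₗ[ℂ] ↥(hA n A) where
  toFun t := ⟨(diagonal t.1, 0), Matrix.isDiag_diagonal _, Matrix.isDiag_zero,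
    by simpa [Matrix.trace_diagonal] using (aux_mem_T n A _).1 t.2, by simp⟩
  map_add' s t := by
    apply Subtype.ext; apply Prod.ext <;> simp
  map_smul' c t := by
    apply Subtype.ext; apply Prod.ext <;> simp [Matrix.diagonal_smul]

/-- odd diagonal element -/
def auxOd : ↥(auxT n A) →ₗ[ℂ] ↥(hA n A) where
  toFun t := ⟨(0, diagonal t.1), Matrix.isDiag_zero, Matrix.isDiag_diagonal _, by simp,
    by simpa [Matrix.trace_diagonal] using (aux_mem_T n A _).1 t.2⟩
  map_add' s t := by
    apply Subtype.ext; apply Prod.ext <;> simp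
  map_smul' c t := by
    apply Subtype.ext; apply Prod.ext <;> simp [Matrix.diagonal_smul]

lemma aux_decomp (x : ↥(hA n A)) : ∃ s t : ↥(auxT n A),
    x = auxEv n A s + auxOd n A t ∧ (∀ i, s.1 i = x.1.1 i i) ∧ (∀ i, t.1 i = x.1.2 i i) := by
  obtain ⟨⟨X, Y⟩, hX, hY, hX0, hY0⟩ := x
  refine ⟨⟨fun i => X i i, (aux_mem_T n A _).2 hX0⟩, ⟨fun i => Y i i, (aux_mem_T n A _).2 hY0⟩,
    ?_, fun _ => rfl, fun _ => rfl⟩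
  apply Subtype.ext
  apply Prod.ext
  · simp only [auxEv, auxOd, LinearMap.coe_mk, AddHom.coe_mk, Submodule.coe_add, Prod.fst_add,
      Prod.snd_add, add_zero, zero_add]
    exact hX.diagonal_diag.symm
  · simp only [auxEv, auxOd, LinearMap.coe_mk, AddHom.coe_mk, Submodule.coe_add, Prod.fst_add,
      Prod.snd_add, add_zero, zero_add]
    exact hY.diagonal_diag.symm

/-- the tuple `f (e_i - e_j)` -/
def auxD (i j : Fin (n + 1)) : A →ₗ[ℂ] ↥(auxT n A) :=
  LinearMap.codRestrict (auxT n A)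
    (LinearMap.single ℂ (fun _ => A) i - LinearMap.single ℂ (fun _ => A) j)
    (by intro c; rw [aux_mem_T]; simp [Finset.sum_sub_distrib])

lemma auxD_apply (i j : Fin (n + 1)) (f : A) (k : Fin (n + 1)) :
    (auxD n A i j f).1 k = (if k = i then f else 0) - (if k = j then f else 0) := by
  simp [auxD, Pi.single_apply]

lemma auxD_sum (t : ↥(auxT n A)) : t = ∑ i, auxD n A i 0 (t.1 i) := by
  apply Subtype.ext
  funext k
  have := (aux_mem_T n A _).1 t.2
  rw [Submodule.coe_sum, Finset.sum_apply]
  simp only [auxD_apply, Finset.sum_sub_distrib]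
  by_cases hk : k = 0
  · simp [hk, this]
  · simp [hk]

lemma auxOd_br (s t u : ↥(auxT n A)) (c : A)
    (h : ∀ k, s.1 k * t.1 k + t.1 k * s.1 k = u.1 k + c) :
    (⟨qbr n A (auxOd n A s) (auxOd n A t), hbr_mem n A (auxOd n A s).2 (auxOd n A t).2⟩ : ↥(hA n A))
      = auxEv n A u := by
  have hu := (aux_mem_T n A _).1 u.2
  apply Subtype.ext
  apply Prod.ext
  · simp only [qbr, auxOd, auxEv, LinearMap.coe_mk, AddHom.coe_mk, mul_zero, sub_zero, zero_add,
      Matrix.diagonal_mul_diagonal, Matrix.diagonal_add, h, Matrix.trace_diagonal]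
    rw [Finset.sum_add_distrib, hu, zero_add]
    have hc : ((n : ℂ) + 1)⁻¹ • ∑ _i : Fin (n + 1), c = c := by
      rw [Finset.sum_const, Finset.card_univ, Fintype.card_fin, ← Nat.cast_smul_eq_nsmul ℂ,
        smul_smul]
      push_cast
      rw [inv_mul_cancel₀ (by exact_mod_cast Nat.cast_add_one_ne_zero (R := ℂ) n), one_smul]
    rw [hc]
    ext i j
    by_cases hij : i = j
    · subst hij; simp
    · simp [hij]
  · simp [qbr, auxOd, auxEv]

/-- bracket tuple -/
lemma auxOd_br_ex (s t : ↥(auxT n A)) : ∃ (u : ↥(auxT n A)) (c : A),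
    (∀ k, s.1 k * t.1 k + t.1 k * s.1 k = u.1 k + c) ∧
    ∀ I : Ideal A, (∀ k, s.1 k ∈ I) → ∀ k, u.1 k ∈ I := by
  set w : Fin (n + 1) → A := fun k => s.1 k * t.1 k + t.1 k * s.1 k with hw
  set c : A := ((n : ℂ) + 1)⁻¹ • ∑ k, w k with hc
  refine ⟨⟨fun k => w k - c, ?_⟩, c, fun k => by simp [hw], ?_⟩
  · rw [aux_mem_T, Finset.sum_sub_distrib, Finset.sum_const, Finset.card_univ, Fintype.card_fin,
      ← Nat.cast_smul_eq_nsmul ℂ, hc, smul_smul]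
    push_cast
    rw [mul_inv_cancel₀ (by exact_mod_cast Nat.cast_add_one_ne_zero (R := ℂ) n), one_smul, sub_self]
  · intro I hI k
    have hwI : ∀ k, w k ∈ I := fun k =>
      add_mem (I.mul_mem_right _ (hI k)) (I.mul_mem_left _ (hI k))
    refine sub_mem (hwI k) ?_
    rw [hc, Algebra.smul_def]
    exact I.mul_mem_left _ (sum_mem fun k _ => hwI k)

section AuxRep

variable {n A}

lemma aux_even_comm {ρ : HAct n A M} (hrep : HAct.IsRep n A ρ) (s : ↥(auxT n A)) (y : ↥(hA n A))
    (m : M) : ρ.act (auxEv n A s) (ρ.act y m) = ρ.act y (ρ.act (auxEv n A s) m) := by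
  have h := hrep.2.2.2.1 (auxEv n A s) y (Or.inl rfl)
  have h0 : (⟨qbr n A (auxEv n A s) y, hbr_mem n A (auxEv n A s).2 y.2⟩ : ↥(hA n A)) = 0 := by
    obtain ⟨a, b, rfl, -, -⟩ := aux_decomp n A y
    apply Subtype.ext
    apply Prod.ext
    · simp [qbr, auxEv, auxOd, mul_comm]
    · simp [qbr, auxEv, auxOd, mul_comm]
  rw [h0, map_zero] at h
  exact (sub_eq_zero.1 (LinearMap.congr_fun h m).symm)

lemma aux_P_ev {ρ : HAct n A M} (hrep : HAct.IsRep n A ρ) (s : ↥(auxT n A)) (m : M) :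
    ρ.P (ρ.act (auxEv n A s) m) = ρ.act (auxEv n A s) (ρ.P m) :=
  LinearMap.congr_fun (hrep.2.1 (auxEv n A s) rfl) m

lemma aux_P_od {ρ : HAct n A M} (hrep : HAct.IsRep n A ρ) (s : ↥(auxT n A)) (m : M) :
    ρ.P (ρ.act (auxOd n A s) m) = - ρ.act (auxOd n A s) (ρ.P m) :=
  LinearMap.congr_fun (hrep.2.2.1 (auxOd n A s) rfl) m

lemma aux_od_od {ρ : HAct n A M} (hrep : HAct.IsRep n A ρ) (s t u : ↥(auxT n A)) (c : A)
    (h : ∀ k, s.1 k * t.1 k + t.1 k * s.1 k = u.1 k + c) (m : M) :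
    ρ.act (auxOd n A s) (ρ.act (auxOd n A t) m) + ρ.act (auxOd n A t) (ρ.act (auxOd n A s) m)
      = ρ.act (auxEv n A u) m := by
  have h1 := hrep.2.2.2.2 (auxOd n A s) (auxOd n A t) rfl rfl
  rw [auxOd_br n A s t u c h] at h1
  exact (LinearMap.congr_fun h1 m).symm

lemma aux_step1 (hn : 2 ≤ n) {ρ : HAct n A M} (hrep : HAct.IsRep n A ρ) (f : A)
    (hf : ∀ i j, ρ.act (auxOd n A (auxD n A i j f)) = 0) (g : A) (i j : Fin (n + 1)) :
    ρ.act (auxEv n A (auxD n A i j (f * g))) = 0 := by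
  by_cases hij : i = j
  · have : auxD n A i j (f * g) = 0 := by
      apply Subtype.ext; funext k; rw [auxD_apply]; simp [hij]
    rw [this]; simp
  · obtain ⟨k, hk⟩ : ∃ k : Fin (n + 1), k ∉ ({i, j} : Finset (Fin (n + 1))) := by
      by_contra! hall
      have h1 : (Finset.univ : Finset (Fin (n + 1))) ⊆ {i, j} := fun k _ => hall k
      have h2 := Finset.card_le_card h1
      have h3 := Finset.card_le_two (a := i) (b := j)
      rw [Finset.card_univ, Fintype.card_fin] at h2
      omega
    simp only [Finset.mem_insert, Finset.mem_singleton, not_or] at hk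
    have h := aux_od_od hrep (auxD n A i j f) (auxD n A i k g + auxD n A j k g)
      ((2 : ℂ) • auxD n A i j (f * g)) 0 (by
        intro l
        rw [Submodule.coe_add, Submodule.coe_smul, Pi.add_apply, Pi.smul_apply, two_smul]
        simp only [auxD_apply]
        by_cases hli : l = i
        · subst hli
          simp [hij, Ne.symm hk.1]; ring
        · by_cases hlj : l = j
          · subst hlj
            simp [hli, Ne.symm hk.2]; ring
          · simp [hli, hlj])
    ext m
    have h' := h m
    rw [hf i j, map_smul, map_smul] at h'
    simp only [LinearMap.zero_apply, map_zero, add_zero, LinearMap.smul_apply] at h'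
    simpa using h'.symm

lemma aux_step1' (hn : 2 ≤ n) {ρ : HAct n A M} (hrep : HAct.IsRep n A ρ) (f : A)
    (hf : ∀ i j, ρ.act (auxOd n A (auxD n A i j f)) = 0) (u : ↥(auxT n A))
    (hu : ∀ k, u.1 k ∈ Ideal.span {f}) :
    ρ.act (auxEv n A u) = 0 := by
  rw [auxD_sum n A u, map_sum, map_sum]
  refine Finset.sum_eq_zero fun i _ => ?_
  obtain ⟨g, hg⟩ := Ideal.mem_span_singleton.1 (hu i)
  rw [hg]
  exact aux_step1 hn hrep f hf g i 0

lemma aux_step2 (hn : 2 ≤ n) {ρ : HAct n A M} (hrep : HAct.IsRep n A ρ)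
    (hirr : HAct.Irred n A ρ) (f : A)
    (hf : ∀ i j, ρ.act (auxOd n A (auxD n A i j f)) = 0) (s : ↥(auxT n A))
    (hs : ∀ k, s.1 k ∈ Ideal.span {f}) :
    ρ.act (auxOd n A s) = 0 := by
  have hanti : ∀ t m, ρ.act (auxOd n A s) (ρ.act (auxOd n A t) m)
      = - ρ.act (auxOd n A t) (ρ.act (auxOd n A s) m) := by
    intro t m
    obtain ⟨u, c, huc, hI⟩ := auxOd_br_ex n A s t
    have h := aux_od_od hrep s t u c huc m
    rw [aux_step1' hn hrep f hf u (hI _ hs), LinearMap.zero_apply] at h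
    exact eq_neg_of_add_eq_zero_left h
  have hsq : ∀ m, ρ.act (auxOd n A s) (ρ.act (auxOd n A s) m) = 0 := by
    intro m
    have h := hanti s m
    have h2 : (2 : ℂ) • ρ.act (auxOd n A s) (ρ.act (auxOd n A s) m) = 0 := by
      rw [two_smul]
      exact eq_neg_iff_add_eq_zero.1 h
    exact (smul_eq_zero.1 h2).resolve_left two_ne_zero
  have hinv : HAct.Invt n A ρ (LinearMap.ker (ρ.act (auxOd n A s))) := by
    refine ⟨fun x m hm => ?_, fun m hm => ?_⟩
    · rw [LinearMap.mem_ker] at hm ⊢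
      obtain ⟨a, b, rfl, -, -⟩ := aux_decomp n A x
      rw [map_add, LinearMap.add_apply, map_add, hanti, ← aux_even_comm hrep, hm]
      simp
    · rw [LinearMap.mem_ker] at hm ⊢
      have h := aux_P_od hrep s m
      rw [hm, map_zero] at h
      exact neg_eq_zero.1 h.symm
  rcases hirr.2 _ hinv with h | h
  · ext m
    have h1 : ∀ m, ρ.act (auxOd n A s) m = 0 → m = 0 := fun m hm => by
      have : m ∈ LinearMap.ker (ρ.act (auxOd n A s)) := hm
      rw [h] at this
      simpa using this
    exact h1 _ (hsq m)
  · exact LinearMap.ker_eq_top.1 h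

lemma aux_forward (hn : 2 ≤ n) {ρ : HAct n A M} (hrep : HAct.IsRep n A ρ)
    (hirr : HAct.Irred n A ρ) [FiniteDimensional ℂ M] :
    ∃ I : Ideal A, FiniteDimensional ℂ (A ⧸ I) ∧
        ∀ x : ↥(hA n A), EntriesIn n A I ↑x → ρ.act x = 0 := by
  let K : Ideal A :=
    { carrier := {f | ∀ i j, ρ.act (auxOd n A (auxD n A i j f)) = 0}
      add_mem' := fun {f g} hf hg i j => by
        rw [map_add, map_add, map_add, hf i j, hg i j, add_zero]
      zero_mem' := fun i j => by simp
      smul_mem' := fun g f hf i j => by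
        refine aux_step2 hn hrep hirr f hf _ fun k => ?_
        rw [auxD_apply]
        have h : g • f ∈ Ideal.span {f} :=
          Ideal.mul_mem_left _ _ (Ideal.mem_span_singleton_self f)
        apply sub_mem <;> split_ifs <;> first | exact h | exact zero_mem _ }
  have hK : ∀ f, f ∈ K ↔ ∀ i j, ρ.act (auxOd n A (auxD n A i j f)) = 0 := fun f => Iff.rfl
  refine ⟨K, ?_, ?_⟩
  · let Φ : A →ₗ[ℂ] (Fin (n + 1) → Fin (n + 1) → M →ₗ[ℂ] M) :=
      LinearMap.pi fun i => LinearMap.pi fun j => ρ.act ∘ₗ auxOd n A ∘ₗ auxD n A i j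
    have hker : LinearMap.ker Φ = K.restrictScalars ℂ := by
      ext f
      rw [LinearMap.mem_ker, Submodule.restrictScalars_mem, hK]
      constructor
      · intro h i j
        exact congrFun (congrFun h i) j
      · intro h
        funext i j
        exact h i j
    have h1 : FiniteDimensional ℂ (A ⧸ LinearMap.ker Φ) :=
      Module.Finite.equiv Φ.quotKerEquivRange.symm
    rw [hker] at h1
    exact Module.Finite.equiv (Submodule.Quotient.restrictScalarsEquiv ℂ K)
  · intro x hx
    obtain ⟨s, t, rfl, hs, ht⟩ := aux_decomp n A x
    have hs' : ∀ i, s.1 i ∈ K := fun i => by rw [hs]; exact (hx i i).1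
    have ht' : ∀ i, t.1 i ∈ K := fun i => by rw [ht]; exact (hx i i).2
    have e1 : ρ.act (auxEv n A s) = 0 := by
      rw [auxD_sum n A s, map_sum, map_sum]
      refine Finset.sum_eq_zero fun i _ => ?_
      have := aux_step1 hn hrep (s.1 i) ((hK _).1 (hs' i)) 1 i 0
      rwa [mul_one] at this
    have e2 : ρ.act (auxOd n A t) = 0 := by
      rw [auxD_sum n A t, map_sum, map_sum]
      exact Finset.sum_eq_zero fun i _ => (hK _).1 (ht' i) i 0
    rw [map_add, e1, e2, add_zero]

lemma aux_range_fd {ρ : HAct n A M} (I : Ideal A) [FiniteDimensional ℂ (A ⧸ I)]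
    (hI : ∀ x : ↥(hA n A), EntriesIn n A I ↑x → ρ.act x = 0) :
    FiniteDimensional ℂ (LinearMap.range ρ.act) := by
  let q : A →ₗ[ℂ] (A ⧸ I) := (Ideal.Quotient.mkₐ ℂ I).toLinearMap
  have hq : ∀ a, q a = 0 ↔ a ∈ I := fun a => Ideal.Quotient.eq_zero_iff_mem
  let Φ : ↥(hA n A) →ₗ[ℂ] (Fin (n + 1) → Fin (n + 1) → (A ⧸ I) × (A ⧸ I)) :=
    { toFun := fun x i j => (q (x.1.1 i j), q (x.1.2 i j))
      map_add' := fun x y => by funext i j; simp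
      map_smul' := fun c x => by funext i j; simp }
  have hle : LinearMap.ker Φ ≤ LinearMap.ker ρ.act := by
    intro x hx
    refine hI x fun i j => ?_
    have h := congrFun (congrFun hx i) j
    exact ⟨(hq _).1 (congrArg Prod.fst h), (hq _).1 (congrArg Prod.snd h)⟩
  have h1 : FiniteDimensional ℂ (↥(hA n A) ⧸ LinearMap.ker Φ) :=
    Module.Finite.equiv Φ.quotKerEquivRange.symm
  have h2 : LinearMap.range ((LinearMap.ker Φ).liftQ ρ.act hle) = LinearMap.range ρ.act :=
    Submodule.range_liftQ _ _ _
  rw [← h2]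
  infer_instance

lemma aux_backward {ρ : HAct n A M} (hrep : HAct.IsRep n A ρ)
    (hirr : HAct.Irred n A ρ) (I : Ideal A) [FiniteDimensional ℂ (A ⧸ I)]
    (hI : ∀ x : ↥(hA n A), EntriesIn n A I ↑x → ρ.act x = 0) : FiniteDimensional ℂ M := by
  classical
  have hnt : Nontrivial M := hirr.1
  have hfd := aux_range_fd I hI
  have hfdE : (LinearMap.range (ρ.act ∘ₗ auxEv n A)).FG := by
    have : FiniteDimensional ℂ (LinearMap.range (ρ.act ∘ₗ auxEv n A)) :=
      Submodule.finiteDimensional_of_le (LinearMap.range_comp_le_range _ _)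
    exact Module.Finite.iff_fg.1 this
  have hfdO : (LinearMap.range (ρ.act ∘ₗ auxOd n A)).FG := by
    have : FiniteDimensional ℂ (LinearMap.range (ρ.act ∘ₗ auxOd n A)) :=
      Submodule.finiteDimensional_of_le (LinearMap.range_comp_le_range _ _)
    exact Module.Finite.iff_fg.1 this
  obtain ⟨GE, hGE⟩ := hfdE
  obtain ⟨GO, hGO⟩ := hfdO
  have hGEmem : ∀ Y ∈ GE, ∃ s, ρ.act (auxEv n A s) = Y := fun Y hY => by
    have : Y ∈ LinearMap.range (ρ.act ∘ₗ auxEv n A) := hGE ▸ Submodule.subset_span hY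
    exact this
  have hGOmem : ∀ Y ∈ GO, ∃ s, ρ.act (auxOd n A s) = Y := fun Y hY => by
    have : Y ∈ LinearMap.range (ρ.act ∘ₗ auxOd n A) := hGO ▸ Submodule.subset_span hY
    exact this
  have hcomm : ∀ a ∈ (GE : Set (Module.End ℂ M)), ∀ b ∈ (GE : Set (Module.End ℂ M)),
      a * b = b * a := by
    intro a ha b hb
    obtain ⟨s, rfl⟩ := hGEmem a ha
    obtain ⟨t, rfl⟩ := hGEmem b hb
    ext m
    exact aux_even_comm hrep s _ m
  let Z : Subalgebra ℂ (Module.End ℂ M) := Algebra.adjoin ℂ (GE : Set (Module.End ℂ M))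
  let instZ : CommRing Z := Algebra.adjoinCommRingOfComm ℂ hcomm
  have hft : Algebra.FiniteType ℂ Z :=
    (Subalgebra.fg_iff_finiteType Z).1 (Subalgebra.fg_adjoin_finset GE)
  -- even elements act through `Z`
  have hev : ∀ s, ρ.act (auxEv n A s) ∈ Z := by
    intro s
    have h1 : ρ.act (auxEv n A s) ∈ Submodule.span ℂ (GE : Set (Module.End ℂ M)) := by
      rw [hGE]; exact ⟨s, rfl⟩
    exact Algebra.span_le_adjoin ℂ _ h1
  have hcen : ∀ T : Module.End ℂ M, (∀ s m, ρ.act (auxEv n A s) (T m) = T (ρ.act (auxEv n A s) m)) →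
      ∀ z ∈ Z, ∀ m, z (T m) = T (z m) := by
    intro T hT z hz
    induction hz using Algebra.adjoin_induction with
    | mem x hx =>
      obtain ⟨s, rfl⟩ := hGEmem x hx
      exact hT s
    | algebraMap r => intro m; simp [Module.algebraMap_end_apply]
    | add x y _ _ hx hy => intro m; simp [hx, hy]
    | mul x y _ _ hx hy => intro m; simp [hx, hy]
  have hcenA : ∀ y, ∀ z ∈ Z, ∀ m, z (ρ.act y m) = ρ.act y (z m) := fun y =>
    hcen (ρ.act y) fun s m => aux_even_comm hrep s y m
  have hcenP : ∀ z ∈ Z, ∀ m, z (ρ.P m) = ρ.P (z m) :=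
    hcen ρ.P fun s m => (aux_P_ev hrep s m).symm
  let lin : ∀ T : Module.End ℂ M, (∀ z ∈ Z, ∀ m, z (T m) = T (z m)) → (M →ₗ[Z] M) :=
    fun T hT =>
    { toFun := T
      map_add' := T.map_add
      map_smul' := fun z m => (hT z.1 z.2 m).symm }
  obtain ⟨v, hv⟩ := exists_ne (0 : M)
  choose! τ hτ using hGOmem
  have key := aux_fg (lin ρ.P hcenP) (fun m => LinearMap.congr_fun hrep.1 m) v
    (GO.image fun Y => lin (ρ.act (auxOd n A (τ Y))) (hcenA _))
    (by
      intro Y hY m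
      obtain ⟨y, hy, rfl⟩ := Finset.mem_image.1 hY
      exact aux_P_od hrep _ m)
    (by
      intro Y hY
      obtain ⟨y, hy, rfl⟩ := Finset.mem_image.1 hY
      obtain ⟨u, c, huc, -⟩ := auxOd_br_ex n A (τ y) (τ y)
      refine ⟨⟨_, hev ((2 : ℂ)⁻¹ • u)⟩, fun m => ?_⟩
      have h := aux_od_od hrep _ _ u c huc m
      change ρ.act (auxOd n A (τ y)) (ρ.act (auxOd n A (τ y)) m) =
        ρ.act (auxEv n A ((2 : ℂ)⁻¹ • u)) m
      rw [map_smul, map_smul, LinearMap.smul_apply, ← h, ← two_smul ℂ, smul_smul]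
      norm_num)
    (by
      intro Y hY Y' hY'
      obtain ⟨y, hy, rfl⟩ := Finset.mem_image.1 hY
      obtain ⟨y', hy', rfl⟩ := Finset.mem_image.1 hY'
      obtain ⟨u, c, huc, -⟩ := auxOd_br_ex n A (τ y) (τ y')
      exact ⟨⟨_, hev u⟩, fun m => aux_od_od hrep _ _ u c huc m⟩)
  obtain ⟨S, hSfg, hvS, hPS, hYS⟩ := key
  have hSinv : HAct.Invt n A ρ (S.restrictScalars ℂ) := by
    refine ⟨fun x m hm => ?_, fun m hm => hPS m hm⟩
    obtain ⟨a, b, rfl, -, -⟩ := aux_decomp n A x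
    rw [map_add, LinearMap.add_apply]
    refine add_mem (S.smul_mem (⟨_, hev a⟩ : Z) hm) ?_
    have h1 : ρ.act (auxOd n A b) ∈ Submodule.span ℂ (GO : Set (Module.End ℂ M)) := by
      rw [hGO]; exact ⟨b, rfl⟩
    have h2 : Submodule.span ℂ (GO : Set (Module.End ℂ M)) ≤
        (S.restrictScalars ℂ).comap (LinearMap.applyₗ m) := by
      rw [Submodule.span_le]
      intro Y hY
      have := hYS _ (Finset.mem_image_of_mem _ hY) m hm
      change ρ.act (auxOd n A (τ Y)) m ∈ S at this
      rwa [hτ Y hY] at this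
    exact h2 h1
  have hStop : S = ⊤ := by
    rcases hirr.2 _ hSinv with h | h
    · exfalso
      have : v ∈ S.restrictScalars ℂ := hvS
      rw [h] at this
      exact hv (by simpa using this)
    · rw [eq_top_iff]
      intro m _
      have : m ∈ S.restrictScalars ℂ := by rw [h]; trivial
      exact this
  have hfin : Module.Finite Z M := ⟨hStop ▸ hSfg⟩
  refine aux_fd_of_field (R := Z) (V := M) ?_ ?_
  · intro r hr
    apply Subtype.ext
    ext m
    exact hr m
  · intro r hr m
    have hinv : HAct.Invt n A ρ (LinearMap.range r.1) := by
      refine ⟨?_, ?_⟩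
      · rintro x _ ⟨m, rfl⟩
        exact ⟨_, hcenA x r.1 r.2 m⟩
      · rintro _ ⟨m, rfl⟩
        exact ⟨_, hcenP r.1 r.2 m⟩
    rcases hirr.2 _ hinv with h | h
    · exact absurd (Subtype.ext (LinearMap.range_eq_bot.1 h)) hr
    · have : m ∈ LinearMap.range r.1 := by rw [h]; trivial
      exact this

end AuxRep

/-- An irreducible module `V` over `𝔥 ⊗ A` (`𝔥` the standard Cartan subalgebra of
`𝔮(n)`, `n ≥ 2`, `A` a commutative unital `ℂ`-algebra) is finite-dimensional if and
only if there is a finite-codimensional ideal `I ⊆ A` with `(𝔥 ⊗ I) V = 0`. -/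
theorem cartan_irred_fd_iff_finite_codim (hn : 2 ≤ n)
    (ρ : HAct n A M) (hrep : HAct.IsRep n A ρ) (hirr : HAct.Irred n A ρ) :
    FiniteDimensional ℂ M ↔
      ∃ I : Ideal A, FiniteDimensional ℂ (A ⧸ I) ∧
        ∀ x : ↥(hA n A), EntriesIn n A I ↑x → ρ.act x = 0 := by

  constructor
  · intro _
    exact aux_forward hn hrep hirr
  · rintro ⟨I, _, hI⟩
    exact aux_backward hrep hirr I hI
end
end

section
/- For every $\psi \in \mathcal{L}(\mathfrak{h} \otimes A)$ there exists a unique (up to isomorphism) irreducible finite-dimensional $\mathfrak{h} \otimes A$-module $H(\psi)$ on which every $x \in \mathfrak{h}_{\bar 0} \otimes A$ acts by the scalar $\psi(x)$; moreover every irreducible finite-dimensional $\mathfrak{h} \otimes A$-module is isomorphic to $H(\psi)$ for a unique $\psi \in \mathcal{L}(\mathfrak{h} \otimes A)$, so that $\psi \mapsto H(\psi)$ is a bijection from $\mathcal{L}(\mathfrak{h} \otimes A)$ onto the set of isomorphism classes of irreducible finite-dimensional $\mathfrak{h} \otimes A$-modules. -/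
open Matrix

noncomputable section

variable (n : ℕ) (A : Type*) [CommRing A] [Algebra ℂ A]

variable {M : Type*} [AddCommGroup M] [Module ℂ M]

variable {M : Type*} [AddCommGroup M] [Module ℂ M]

/-- A bundled `ℤ₂`-graded `𝔥 ⊗ A`-module. -/
structure CartanMod (n : ℕ) (A : Type) [CommRing A] [Algebra ℂ A] where
  M : Type
  [i1 : AddCommGroup M]
  [i2 : Module ℂ M]
  ρ : HAct n A M

attribute [instance] CartanMod.i1 CartanMod.i2

variable {B : Type} [CommRing B] [Algebra ℂ B]

/-- The module `V` is irreducible, finite-dimensional, and `𝔥₀ ⊗ A` acts on it via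
the functional `ψ` (so `V ≅ H(ψ)`). -/
def IsHpsi (V : CartanMod n B) (ψ : ↥(h0A n B) →ₗ[ℂ] ℂ) : Prop :=
  HAct.IsRep n B V.ρ ∧ HAct.Irred n B V.ρ ∧ FiniteDimensional ℂ V.M ∧
    ∀ (p : QPair n B) (hp : p ∈ h0A n B),
      V.ρ.act ⟨p, h0A_le_hA n B hp⟩ = ψ ⟨p, hp⟩ • (LinearMap.id : V.M →ₗ[ℂ] V.M)

/-- Isomorphism of `𝔥 ⊗ A`-modules (homomorphisms need not be homogeneous). -/
def HModIso (V W : CartanMod n B) : Prop :=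
  ∃ e : V.M ≃ₗ[ℂ] W.M, ∀ (x : ↥(hA n B)) (v : V.M), e (V.ρ.act x v) = W.ρ.act x (e v)

section CliffordHelpers

lemma clif_exist (r : ℕ) (c : Fin r → ℂ) :
    ∃ (M : Type) (_ : AddCommGroup M) (_ : Module ℂ M) (_ : FiniteDimensional ℂ M)
      (_ : Nontrivial M) (g : Fin r → M →ₗ[ℂ] M),
      (∀ i m, g i (g i m) = c i • m) ∧
      (∀ i j, i ≠ j → ∀ m, g i (g j m) + g j (g i m) = 0) := by
  induction r with
  | zero => exact ⟨ℂ, inferInstance, inferInstance, inferInstance, inferInstance, fun i => 0,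
      fun i => i.elim0, fun i => i.elim0⟩
  | succ r ih =>
    obtain ⟨M, i1, i2, i3, i4, g, h1, h2⟩ := ih (fun i => c i.succ)
    refine ⟨M × M, inferInstance, inferInstance, inferInstance, inferInstance,
      Fin.cons ((c 0 • LinearMap.snd ℂ M M).prod (LinearMap.fst ℂ M M))
        (fun i => (g i).prodMap (-(g i))), ?_, ?_⟩
    · intro i
      refine Fin.cases ?_ (fun i => ?_) i
      · rintro ⟨x, y⟩; simp
      · rintro ⟨x, y⟩; simp [h1]
    · intro i j
      refine Fin.cases ?_ (fun i => ?_) i <;> refine Fin.cases ?_ (fun j => ?_) j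
      · intro h; exact absurd rfl h
      · rintro - ⟨x, y⟩; simp
      · rintro - ⟨x, y⟩; simp
      · rintro h ⟨x, y⟩
        have h' : i ≠ j := fun e => h (by rw [e])
        have := h2 i j h'
        simp [this]

lemma clif_exist_irred (r : ℕ) (c : Fin r → ℂ) :
    ∃ (M : Type) (_ : AddCommGroup M) (_ : Module ℂ M) (_ : FiniteDimensional ℂ M)
      (_ : Nontrivial M) (g : Fin r → M →ₗ[ℂ] M),
      ((∀ i m, g i (g i m) = c i • m) ∧
      (∀ i j, i ≠ j → ∀ m, g i (g j m) + g j (g i m) = 0)) ∧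
      ∀ N : Submodule ℂ M, (∀ i, ∀ m ∈ N, g i m ∈ N) → N = ⊥ ∨ N = ⊤ := by
  classical
  let Q : ℕ → Prop := fun d => ∃ (M : Type) (_ : AddCommGroup M) (_ : Module ℂ M)
      (_ : FiniteDimensional ℂ M)
      (_ : Nontrivial M) (g : Fin r → M →ₗ[ℂ] M),
      ((∀ i m, g i (g i m) = c i • m) ∧
      (∀ i j, i ≠ j → ∀ m, g i (g j m) + g j (g i m) = 0)) ∧ Module.finrank ℂ M = d
  have hQ : ∃ d, Q d := by
    obtain ⟨M, i1, i2, i3, i4, g, h1, h2⟩ := clif_exist r c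
    exact ⟨_, M, i1, i2, i3, i4, g, ⟨h1, h2⟩, rfl⟩
  obtain ⟨M, i1, i2, i3, i4, g, ⟨h1, h2⟩, hd⟩ := Nat.find_spec hQ
  refine ⟨M, i1, i2, i3, i4, g, ⟨h1, h2⟩, fun N hN => ?_⟩
  by_contra! hc
  obtain ⟨hb, ht⟩ := hc
  have hlt : Module.finrank ℂ N < Nat.find hQ := by
    rw [← hd]; exact Submodule.finrank_lt ht
  refine Nat.find_min hQ hlt ⟨N, inferInstance, inferInstance, inferInstance,
    Submodule.nontrivial_iff_ne_bot.mpr hb, fun i => (g i).restrict (hN i), ⟨?_, ?_⟩, rfl⟩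
  · intro i m; ext; simp [h1]
  · intro i j hij m; ext; simp [h2 i j hij]

lemma clif_intertwine {r : ℕ} (c : Fin r → ℂ) {M N : Type} [AddCommGroup M] [Module ℂ M]
    [AddCommGroup N] [Module ℂ N] [Nontrivial M] [Nontrivial N]
    (g : Fin r → M →ₗ[ℂ] M) (k : Fin r → N →ₗ[ℂ] N) (P : N →ₗ[ℂ] N)
    (hP : ∀ m, P (P m) = m) (hPk : ∀ i m, P (k i m) = - k i (P m))
    (g1 : ∀ i m, g i (g i m) = c i • m)
    (g2 : ∀ i j, i ≠ j → ∀ m, g i (g j m) + g j (g i m) = 0)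
    (k1 : ∀ i m, k i (k i m) = c i • m)
    (k2 : ∀ i j, i ≠ j → ∀ m, k i (k j m) + k j (k i m) = 0)
    (g0 : ∀ i, c i = 0 → g i = 0) (k0 : ∀ i, c i = 0 → k i = 0) :
    ∃ T : M →ₗ[ℂ] N, T ≠ 0 ∧ ∀ i m, k i (T m) = T (g i m) := by
  classical
  suffices h : ∀ s : Finset (Fin r), ∃ T : M →ₗ[ℂ] N, T ≠ 0 ∧
      ∀ i ∈ s, ∀ m, k i (T m) = T (g i m) by
    obtain ⟨T, hT, h⟩ := h Finset.univ
    exact ⟨T, hT, fun i => h i (Finset.mem_univ i)⟩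
  intro s
  induction s using Finset.induction_on with
  | empty =>
    obtain ⟨T, hT⟩ := exists_ne (0 : M →ₗ[ℂ] N)
    exact ⟨T, hT, by simp⟩
  | insert a s ha ih =>
    obtain ⟨T, hT, h⟩ := ih
    by_cases hc : c a = 0
    · refine ⟨T, hT, fun i hi m => ?_⟩
      rcases Finset.mem_insert.mp hi with rfl | hi
      · simp [g0 _ hc, k0 _ hc]
      · exact h i hi m
    have kk : ∀ i, i ≠ a → ∀ m, k i (k a m) = - k a (k i m) := fun i hi m =>
      eq_neg_of_add_eq_zero_left (k2 i a hi m)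
    have gg : ∀ i, i ≠ a → ∀ m, g a (g i m) = - g i (g a m) := fun i hi m =>
      eq_neg_of_add_eq_zero_right (g2 i a hi m)
    by_cases hp : c a • T + k a ∘ₗ T ∘ₗ g a = 0
    · have hm : c a • T - k a ∘ₗ T ∘ₗ g a ≠ 0 := by
        intro hm
        have h3 : (2 * c a) • T = 0 := by
          have := congrArg₂ (· + ·) hp hm
          simp only [add_zero] at this
          rw [← this]; module
        rcases smul_eq_zero.mp h3 with h3 | h3
        · simp [hc] at h3
        · exact hT h3
      refine ⟨k a ∘ₗ P ∘ₗ (c a • T - k a ∘ₗ T ∘ₗ g a), ?_, ?_⟩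
      · intro h0
        apply hm
        ext m
        have h5 := LinearMap.congr_fun h0 m
        have h6 := congrArg (fun z => P (k a z)) h5
        simp only [LinearMap.comp_apply, k1, map_smul, hP, LinearMap.zero_apply, map_zero] at h6
        simpa [hc] using h6
      · intro i hi m
        rcases Finset.mem_insert.mp hi with rfl | hi
        · simp [k1, g1, hPk]
          abel
        · have hne : i ≠ a := fun e => ha (e ▸ hi)
          simp [kk i hne, gg i hne, hPk, ← h i hi]
          try abel
    · refine ⟨_, hp, fun i hi m => ?_⟩
      rcases Finset.mem_insert.mp hi with rfl | hi
      · simp [k1, g1, add_comm]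
      · have hne : i ≠ a := fun e => ha (e ▸ hi)
        simp [kk i hne, gg i hne, ← h i hi]

lemma orth_family {U Q : Type} [AddCommGroup U] [Module ℂ U] [AddCommGroup Q] [Module ℂ Q]
    [FiniteDimensional ℂ Q] (f : U →ₗ[ℂ] U →ₗ[ℂ] ℂ) (hf : ∀ x y, f x y = f y x)
    (p : U →ₗ[ℂ] Q) (hp : ∀ x, p x = 0 → ∀ y, f x y = 0) :
    ∃ (r : ℕ) (e : Fin r → U) (ξ : Fin r → U →ₗ[ℂ] ℂ),
      (∀ i j, i ≠ j → f (e i) (e j) = 0) ∧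
      (∀ i j, ξ i (e j) = if j = i then 1 else 0) ∧
      ∀ x y, f (x - ∑ i, ξ i x • e i) y = 0 := by
  obtain ⟨C, hC⟩ := Submodule.exists_isCompl (LinearMap.ker p)
  have hfd : FiniteDimensional ℂ C := by
    have : Function.Injective (p ∘ₗ C.subtype) := by
      rw [← LinearMap.ker_eq_bot, LinearMap.ker_comp, ← Submodule.disjoint_iff_comap_eq_bot]
      exact hC.symm.disjoint
    exact FiniteDimensional.of_injective _ this
  let fC : LinearMap.BilinForm ℂ C := f.compl₁₂ C.subtype C.subtype
  have hs : LinearMap.IsSymm fC := ⟨fun x y => hf _ _⟩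
  obtain ⟨v, hv⟩ := LinearMap.BilinForm.exists_orthogonal_basis (V := C) (B := fC) hs
  refine ⟨_, fun i => (v i : U), fun i => v.coord i ∘ₗ C.projectionOnto _ hC.symm, ?_, ?_, ?_⟩
  · intro i j hij
    exact hv hij
  · intro i j
    simp only [LinearMap.comp_apply]
    rw [Submodule.projectionOnto_apply_left, Module.Basis.coord_apply,
      Module.Basis.repr_self, Finsupp.single_apply]
  · intro x y
    apply hp
    have h1 : ∑ i, (v.coord i (C.projectionOnto _ hC.symm x)) • (v i : U) =
        (C.projectionOnto _ hC.symm x : U) := by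
      have := congrArg (Subtype.val) (v.sum_repr (C.projectionOnto _ hC.symm x))
      rw [AddSubmonoidClass.coe_finsetSum] at this
      exact this
    simp only [LinearMap.comp_apply]
    rw [h1]
    have h2 : C.projectionOnto _ hC.symm (x - (C.projectionOnto _ hC.symm x : U)) = 0 := by
      rw [map_sub, Submodule.projectionOnto_apply_left, sub_self]
    exact (Submodule.projectionOnto_apply_eq_zero_iff hC.symm).mp h2

end CliffordHelpers

section CartanHelpers

lemma diag_comm {X Y : QMat n B} (hX : X.IsDiag) (hY : Y.IsDiag) : X * Y = Y * X := by
  rw [← hX.diagonal_diag, ← hY.diagonal_diag, Matrix.diagonal_mul_diagonal,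
    Matrix.diagonal_mul_diagonal]
  congr 1; ext i; exact mul_comm _ _

/-- The odd part of the Cartan subalgebra, as a space of matrices. -/
def hU (n : ℕ) (B : Type) [CommRing B] [Algebra ℂ B] : Submodule ℂ (QMat n B) where
  carrier := {Y | Y.IsDiag ∧ Y.trace = 0}
  add_mem' := fun hp hq => ⟨hp.1.add hq.1, by simp [hp.2, hq.2]⟩
  zero_mem' := ⟨Matrix.isDiag_zero, by simp⟩
  smul_mem' := fun c _ hp => ⟨hp.1.smul c, by simp [hp.2]⟩

/-- Inclusion of the odd part. -/
def iU (n : ℕ) (B : Type) [CommRing B] [Algebra ℂ B] : hU n B →ₗ[ℂ] hA n B where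
  toFun y := ⟨(0, y), ⟨Matrix.isDiag_zero, y.2.1, by simp, y.2.2⟩⟩
  map_add' x y := by ext <;> simp
  map_smul' c x := by ext <;> simp

/-- Projection to the even part. -/
def evP (n : ℕ) (B : Type) [CommRing B] [Algebra ℂ B] : hA n B →ₗ[ℂ] h0A n B where
  toFun y := ⟨(y.1.1, 0), ⟨rfl, y.2.1, y.2.2.2.1⟩⟩
  map_add' x y := by ext <;> simp
  map_smul' c x := by ext <;> simp

/-- Projection to the odd part. -/
def odP (n : ℕ) (B : Type) [CommRing B] [Algebra ℂ B] : hA n B →ₗ[ℂ] hU n B where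
  toFun y := ⟨y.1.2, ⟨y.2.2.1, y.2.2.2.2⟩⟩
  map_add' x y := by ext; simp
  map_smul' c x := by ext; simp

/-- Inclusion of the even part. -/
def iE (n : ℕ) (B : Type) [CommRing B] [Algebra ℂ B] : h0A n B →ₗ[ℂ] hA n B :=
  Submodule.inclusion (h0A_le_hA n B)

lemma ev_od (x : hA n B) : iE n B (evP n B x) + iU n B (odP n B x) = x := by
  apply Subtype.ext
  apply Prod.ext
  · show x.1.1 + 0 = _
    simp
  · show 0 + x.1.2 = _
    simp

/-- The traceless anticommutator. -/
def brM (n : ℕ) (B : Type) [CommRing B] [Algebra ℂ B] (X Y : QMat n B) : QMat n B :=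
  X * Y + Y * X - (((n : ℂ) + 1)⁻¹ • (X * Y + Y * X).trace) • (1 : QMat n B)

lemma qbr_odd (X Y : QMat n B) : qbr n B (0, X) (0, Y) = (brM n B X Y, 0) := by
  simp [qbr, brM]

lemma brM_mem (X Y : hU n B) : ((brM n B X Y, 0) : QPair n B) ∈ h0A n B := by
  have h := hbr_mem n B (iU n B X).2 (iU n B Y).2
  have h2 : qbr n B (iU n B X).1 (iU n B Y).1 = (brM n B X Y, 0) := qbr_odd n _ _
  rw [h2] at h
  exact ⟨rfl, h.1, h.2.2.1⟩

lemma brM_smul (c : ℂ) (X Y : QMat n B) : brM n B (c • X) Y = c • brM n B X Y := by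
  have h : (c • X) * Y + Y * (c • X) = c • (X * Y + Y * X) := by
    rw [smul_mul_assoc, mul_smul_comm, smul_add]
  rw [brM, h, Matrix.trace_smul, smul_comm _ c, brM, smul_sub, smul_assoc c]

/-- The bracket of odd elements. -/
def brU (n : ℕ) (B : Type) [CommRing B] [Algebra ℂ B] :
    hU n B →ₗ[ℂ] hU n B →ₗ[ℂ] h0A n B :=
  LinearMap.mk₂ ℂ (fun X Y => ⟨(brM n B X Y, 0), brM_mem n X Y⟩)
    (by
      intro x y z
      apply Subtype.ext; apply Prod.ext
      · simp [brM, add_mul, mul_add, add_smul]; abel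
      · simp)
    (by
      intro c x z
      apply Subtype.ext; apply Prod.ext
      · show brM n B _ _ = c • brM n B _ _
        rw [← brM_smul]
        simp [brM]
      · simp)
    (by
      intro x y z
      apply Subtype.ext; apply Prod.ext
      · simp [brM, add_mul, mul_add, add_smul]; abel
      · simp)
    (by
      intro c x z
      apply Subtype.ext; apply Prod.ext
      · show brM n B _ _ = c • brM n B _ _
        rw [← brM_smul]
        simp [brM]
      · simp)

lemma brU_comm (x y : hU n B) : brU n B x y = brU n B y x := by
  apply Subtype.ext; apply Prod.ext
  · show brM n B x y = brM n B y x
    rw [brM, brM, add_comm (x.1 * y.1)]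
  · rfl

lemma qbr_even (x y : hA n B) (h : IsEvenElt n B x.1 ∨ IsEvenElt n B y.1) :
    qbr n B x.1 y.1 = 0 := by
  have h1 := diag_comm n x.2.1 y.2.1
  have h2 := diag_comm n x.2.1 y.2.2.1
  have h3 := diag_comm n y.2.1 x.2.2.1
  unfold IsEvenElt at h
  rcases h with h | h
  · simp [qbr, h, h1, h2]
  · simp [qbr, h, h1, h3]

/-- Action of odd elements anticommutes to the bracket. -/
lemma rep_odd (V : CartanMod n B) (hV : HAct.IsRep n B V.ρ) (x y : hU n B) (m : V.M) :
    V.ρ.act (iU n B x) (V.ρ.act (iU n B y) m) + V.ρ.act (iU n B y) (V.ρ.act (iU n B x) m) =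
      V.ρ.act (iE n B (brU n B x y)) m := by
  have h := LinearMap.congr_fun (hV.2.2.2.2 (iU n B x) (iU n B y) rfl rfl) m
  simp only [LinearMap.add_apply, LinearMap.comp_apply] at h
  rw [← h]
  congr 2
  apply Subtype.ext
  exact qbr_odd n _ _

lemma rep_even_comm (V : CartanMod n B) (hV : HAct.IsRep n B V.ρ) (x : h0A n B) (y : hA n B)
    (m : V.M) :
    V.ρ.act (iE n B x) (V.ρ.act y m) = V.ρ.act y (V.ρ.act (iE n B x) m) := by
  have he : IsEvenElt n B (iE n B x).1 := x.2.1
  have h := LinearMap.congr_fun (hV.2.2.2.1 (iE n B x) y (Or.inl he)) m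
  have h0 : (⟨qbr n B (iE n B x).1 y.1, hbr_mem n B (iE n B x).2 y.2⟩ : hA n B) = 0 :=
    Subtype.ext (qbr_even n _ _ (Or.inl he))
  rw [h0, map_zero] at h
  simp only [LinearMap.sub_apply, LinearMap.comp_apply, LinearMap.zero_apply] at h
  exact (sub_eq_zero.mp h.symm)

lemma rep_P_odd (V : CartanMod n B) (hV : HAct.IsRep n B V.ρ) (x : hU n B) (m : V.M) :
    V.ρ.P (V.ρ.act (iU n B x) m) = - V.ρ.act (iU n B x) (V.ρ.P m) := by
  have := LinearMap.congr_fun (hV.2.2.1 (iU n B x) rfl) m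
  simpa using this

lemma rep_P_even (V : CartanMod n B) (hV : HAct.IsRep n B V.ρ) (x : h0A n B) (m : V.M) :
    V.ρ.P (V.ρ.act (iE n B x) m) = V.ρ.act (iE n B x) (V.ρ.P m) := by
  have := LinearMap.congr_fun (hV.2.1 (iE n B x) x.2.1) m
  simpa using this

lemma rep_PP (V : CartanMod n B) (hV : HAct.IsRep n B V.ρ) (m : V.M) :
    V.ρ.P (V.ρ.P m) = m := by
  have := LinearMap.congr_fun hV.1 m
  simpa using this

lemma rep_split (V : CartanMod n B) (x : hA n B) (m : V.M) :
    V.ρ.act x m = V.ρ.act (iE n B (evP n B x)) m + V.ρ.act (iU n B (odP n B x)) m := by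
  conv_lhs => rw [← ev_od n x]
  simp

/-- Radical elements act by zero on irreducible modules. -/
lemma rad_zero (V : CartanMod n B) (ψ : h0A n B →ₗ[ℂ] ℂ) (hV : IsHpsi n V ψ) (z : hU n B)
    (hz : ∀ y, ψ (brU n B z y) = 0) : V.ρ.act (iU n B z) = 0 := by
  obtain ⟨hr, hi, -, hs⟩ := hV
  have hs' : ∀ x m, V.ρ.act (iE n B x) m = ψ x • m := fun x m =>
    LinearMap.congr_fun (hs x.1 x.2) m
  have ho : ∀ y m, V.ρ.act (iU n B z) (V.ρ.act (iU n B y) m) =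
      - V.ρ.act (iU n B y) (V.ρ.act (iU n B z) m) := by
    intro y m
    have := rep_odd n V hr z y m
    rw [hs', hz, zero_smul] at this
    exact eq_neg_of_add_eq_zero_left this
  have hk : HAct.Invt n B V.ρ (LinearMap.ker (V.ρ.act (iU n B z))) := by
    constructor
    · intro x m hm
      rw [LinearMap.mem_ker] at hm ⊢
      rw [rep_split n V x m, map_add, ho, hs', map_smul, hm]
      simp
    · intro m hm
      rw [LinearMap.mem_ker] at hm ⊢
      have := rep_P_odd n V hr z m
      rw [hm, map_zero] at this
      exact neg_eq_zero.mp this.symm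
  rcases hi.2 _ hk with h | h
  · exfalso
    have := hi.1
    obtain ⟨v, hv⟩ := exists_ne (0 : V.M)
    have hinj := LinearMap.ker_eq_bot.mp h
    have h2 : V.ρ.act (iU n B z) (V.ρ.act (iU n B z) v) = 0 := by
      have := ho z v
      have h3 := eq_neg_iff_add_eq_zero.mp this
      rw [← two_smul ℂ] at h3
      exact (smul_eq_zero.mp h3).resolve_left two_ne_zero
    exact hv (hinj ((hinj (h2.trans (map_zero _).symm)).trans (map_zero _).symm))
  · exact LinearMap.ker_eq_top.mp h

lemma brM_entries (I : Ideal B) (X Y : hU n B) (hX : ∀ i j, X.1 i j ∈ I) :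
    EntriesIn n B I ((brM n B X Y, 0) : QPair n B) := by
  have hm : ∀ i j, (X.1 * Y.1 + Y.1 * X.1) i j ∈ I := by
    intro i j
    rw [Matrix.add_apply, Matrix.mul_apply, Matrix.mul_apply]
    exact I.add_mem (I.sum_mem fun k _ => I.mul_mem_right _ (hX _ _))
      (I.sum_mem fun k _ => I.mul_mem_left _ (hX _ _))
  intro i j
  refine ⟨?_, I.zero_mem⟩
  show brM n B X Y i j ∈ I
  rw [brM, Matrix.sub_apply, Matrix.smul_apply, smul_eq_mul]
  refine I.sub_mem (hm i j) (I.mul_mem_right _ ?_)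
  rw [Algebra.smul_def]
  exact I.mul_mem_left _ (I.sum_mem fun k _ => hm k k)

lemma psi_orth (ψ : h0A n B →ₗ[ℂ] ℂ) (hψ : LFun n B ψ) :
    ∃ (r : ℕ) (e : Fin r → hU n B) (ξ : Fin r → hU n B →ₗ[ℂ] ℂ),
      (∀ i j, i ≠ j → ψ (brU n B (e i) (e j)) = 0) ∧
      (∀ i j, ξ i (e j) = if j = i then 1 else 0) ∧
      ∀ x y, ψ (brU n B (x - ∑ i, ξ i x • e i) y) = 0 := by
  obtain ⟨I, hI, h⟩ := hψ
  let p : hU n B →ₗ[ℂ] (Fin (n+1) → Fin (n+1) → B ⧸ I) :=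
    { toFun := fun X i j => Ideal.Quotient.mkₐ ℂ I (X.1 i j)
      map_add' := by intro x y; ext i j; simp
      map_smul' := by
        intro c x; ext i j
        simp only [Submodule.coe_smul, Matrix.smul_apply, Pi.smul_apply, map_smul, RingHom.id_apply] }
  refine orth_family ((brU n B).compr₂ ψ) (fun x y => ?_) p ?_
  · simp [brU_comm n x y]
  · intro x hx y
    apply h
    apply brM_entries
    intro i j
    have := congrFun (congrFun hx i) j
    exact Ideal.Quotient.eq_zero_iff_mem.mp this

lemma psi_form {r : ℕ} (ψ : h0A n B →ₗ[ℂ] ℂ) (e : Fin r → hU n B)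
    (ξ : Fin r → hU n B →ₗ[ℂ] ℂ)
    (h1 : ∀ i j, i ≠ j → ψ (brU n B (e i) (e j)) = 0)
    (h2 : ∀ x y, ψ (brU n B (x - ∑ i, ξ i x • e i) y) = 0) (x y : hU n B) :
    ψ (brU n B x y) = ∑ i, ξ i x * ξ i y * ψ (brU n B (e i) (e i)) := by
  classical
  have h3 : ∀ x y, ψ (brU n B x y) = ∑ i, ξ i x * ψ (brU n B (e i) y) := by
    intro x y
    have := h2 x y
    simp only [map_sub, LinearMap.sub_apply, sub_eq_zero] at this
    rw [this]; simp [LinearMap.sum_apply]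
  rw [h3]
  refine Finset.sum_congr rfl fun i _ => ?_
  rw [brU_comm, h3, Finset.sum_eq_single i]
  · ring
  · intro j _ hj; rw [h1 j i hj, mul_zero]
  · simp

lemma part_exist (ψ : h0A n B →ₗ[ℂ] ℂ) (hψ : LFun n B ψ) :
    ∃ V : CartanMod n B, IsHpsi n V ψ := by
  obtain ⟨r, e, ξ, h1, h12, h2⟩ := psi_orth n ψ hψ
  have hf := psi_form n ψ e ξ h1 h2
  obtain ⟨M, i1, i2, i3, i4, g, ⟨g1, g2⟩, hirr⟩ := clif_exist_irred (r + 1)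
    (Fin.cons 1 (fun i => ψ (brU n B (e i) (e i)) / 2))
  let γ : hU n B →ₗ[ℂ] M →ₗ[ℂ] M := ∑ i, (ξ i).smulRight (g i.succ)
  have hγ : ∀ x m, γ x m = ∑ i, ξ i x • g i.succ m := by
    intro x m; simp [γ, LinearMap.sum_apply]
  have hPP : ∀ m, g 0 (g 0 m) = m := by intro m; rw [g1]; simp
  have hPγ : ∀ x m, g 0 (γ x m) = - γ x (g 0 m) := by
    intro x m
    rw [hγ, hγ, map_sum, ← Finset.sum_neg_distrib]
    refine Finset.sum_congr rfl fun i _ => ?_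
    rw [map_smul, ← smul_neg]
    congr 1
    exact eq_neg_of_add_eq_zero_left (g2 0 i.succ (Fin.succ_ne_zero i).symm m)
  have hγγ : ∀ x y m, γ x (γ y m) + γ y (γ x m) = ψ (brU n B x y) • m := by
    intro x y m
    have hxy : ∀ x y, γ x (γ y m) = ∑ i, ∑ j, (ξ i x * ξ j y) • g i.succ (g j.succ m) := by
      intro x y
      rw [hγ]
      refine Finset.sum_congr rfl fun i _ => ?_
      rw [hγ, map_sum, Finset.smul_sum]
      refine Finset.sum_congr rfl fun j _ => ?_
      rw [map_smul, smul_smul]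
    rw [hxy x y, hxy y x, Finset.sum_comm (f := fun i j => (ξ i y * ξ j x) • g i.succ (g j.succ m)),
      ← Finset.sum_add_distrib, hf, Finset.sum_smul]
    refine Finset.sum_congr rfl fun i _ => ?_
    rw [← Finset.sum_add_distrib, Finset.sum_eq_single i]
    · rw [g1, Fin.cons_succ, smul_smul, smul_smul, ← add_smul]
      congr 1; ring
    · intro j _ hj
      have := g2 i.succ j.succ (fun h => hj (Fin.succ_injective _ h).symm) m
      rw [mul_comm (ξ j y), ← smul_add, this, smul_zero]
    · simp
  let act : hA n B →ₗ[ℂ] M →ₗ[ℂ] M :=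
    (ψ ∘ₗ evP n B).smulRight LinearMap.id + γ ∘ₗ odP n B
  have hact : ∀ x m, act x m = ψ (evP n B x) • m + γ (odP n B x) m := by
    intro x m; simp [act]
  refine ⟨⟨M, ⟨act, g 0⟩⟩, ⟨?_, ?_, ?_, ?_, ?_⟩, ⟨i4, ?_⟩, i3, ?_⟩
  · ext m; exact hPP m
  · intro x hx
    have hx0 : odP n B x = 0 := Subtype.ext hx
    ext m
    show g 0 (act x m) = act x (g 0 m)
    simp [hact, hx0]
  · intro x hx
    have hx0 : evP n B x = 0 := Subtype.ext (Prod.ext hx rfl)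
    ext m
    show g 0 (act x m) = - act x (g 0 m)
    simp [hact, hx0, hPγ]
  · intro x y hxy
    have h0 : (⟨qbr n B x.1 y.1, hbr_mem n B x.2 y.2⟩ : hA n B) = 0 :=
      Subtype.ext (qbr_even n _ _ hxy)
    rw [h0, map_zero]
    ext m
    show 0 = act x (act y m) - act y (act x m)
    rcases hxy with h | h
    · have hx0 : odP n B x = 0 := Subtype.ext h
      simp [hact, hx0, smul_comm (ψ (evP n B x))]
    · have hx0 : odP n B y = 0 := Subtype.ext h
      simp [hact, hx0, smul_comm (ψ (evP n B x))]
  · intro x y hx hy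
    have hx0 : evP n B x = 0 := Subtype.ext (Prod.ext hx rfl)
    have hy0 : evP n B y = 0 := Subtype.ext (Prod.ext hy rfl)
    ext m
    show act _ m = act x (act y m) + act y (act x m)
    have hq : qbr n B x.1 y.1 = (brM n B x.1.2 y.1.2, 0) := by
      rw [← qbr_odd]
      congr 1
      · exact Prod.ext hx rfl
      · exact Prod.ext hy rfl
    have e1 : evP n B ⟨qbr n B x.1 y.1, hbr_mem n B x.2 y.2⟩ =
        brU n B (odP n B x) (odP n B y) :=
      Subtype.ext (Prod.ext (by
        show (qbr n B x.1 y.1).1 = brM n B x.1.2 y.1.2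
        rw [hq]) rfl)
    have e2 : odP n B ⟨qbr n B x.1 y.1, hbr_mem n B x.2 y.2⟩ = 0 :=
      Subtype.ext (congrArg Prod.snd hq)
    rw [hact, e1, e2]
    simp [hact, hx0, hy0, hγγ]
  · intro N hN
    refine hirr N fun i => ?_
    refine Fin.cases ?_ (fun i => ?_) i
    · exact hN.2
    · intro m hm
      have h3 := hN.1 (iU n B (e i)) m hm
      change act (iU n B (e i)) m ∈ N at h3
      have e1 : evP n B (iU n B (e i)) = 0 := rfl
      have e2 : odP n B (iU n B (e i)) = e i := rfl
      rw [hact, e1, e2, hγ] at h3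
      simpa [h12] using h3
  · intro p hp
    ext m
    show act _ m = _
    have e1 : evP n B ⟨p, h0A_le_hA n B hp⟩ = ⟨p, hp⟩ :=
      Subtype.ext (Prod.ext rfl hp.1.symm)
    have e2 : odP n B ⟨p, h0A_le_hA n B hp⟩ = 0 := Subtype.ext hp.1
    rw [hact, e1, e2]
    simp

lemma part_unique (ψ : h0A n B →ₗ[ℂ] ℂ) (hψ : LFun n B ψ) (V W : CartanMod n B)
    (hV : IsHpsi n V ψ) (hW : IsHpsi n W ψ) : HModIso n V W := by
  obtain ⟨r, e, ξ, h1, h12, h2⟩ := psi_orth n ψ hψ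
  have hf := psi_form n ψ e ξ h1 h2
  have hsc : ∀ X : CartanMod n B, IsHpsi n X ψ → ∀ x m, X.ρ.act (iE n B x) m = ψ x • m :=
    fun X hX x m => LinearMap.congr_fun (hX.2.2.2 x.1 x.2) m
  have hsq : ∀ X : CartanMod n B, IsHpsi n X ψ → ∀ i m,
      X.ρ.act (iU n B (e i)) (X.ρ.act (iU n B (e i)) m) =
        (ψ (brU n B (e i) (e i)) / 2) • m := by
    intro X hX i m
    have h := rep_odd n X hX.1 (e i) (e i) m
    rw [hsc X hX, ← two_smul ℂ] at h
    rw [div_eq_inv_mul, mul_smul, ← h, smul_smul]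
    norm_num
  have hac : ∀ X : CartanMod n B, IsHpsi n X ψ → ∀ i j, i ≠ j → ∀ m,
      X.ρ.act (iU n B (e i)) (X.ρ.act (iU n B (e j)) m) +
        X.ρ.act (iU n B (e j)) (X.ρ.act (iU n B (e i)) m) = 0 := by
    intro X hX i j hij m
    rw [rep_odd n X hX.1, hsc X hX, h1 i j hij, zero_smul]
  have hze : ∀ X : CartanMod n B, IsHpsi n X ψ → ∀ i,
      ψ (brU n B (e i) (e i)) / 2 = 0 → X.ρ.act (iU n B (e i)) = 0 := by
    intro X hX i hi
    apply rad_zero n X ψ hX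
    intro y
    rw [hf]
    refine Finset.sum_eq_zero fun j _ => ?_
    rw [h12]
    split_ifs with hij
    · subst hij
      have : ψ (brU n B (e i) (e i)) = 0 := by simpa using hi
      rw [this, mul_zero]
    · simp
  have hod : ∀ X : CartanMod n B, IsHpsi n X ψ → ∀ x m,
      X.ρ.act (iU n B x) m = ∑ i, ξ i x • X.ρ.act (iU n B (e i)) m := by
    intro X hX x m
    have h := LinearMap.congr_fun (rad_zero n X ψ hX _ (h2 x)) m
    simp only [map_sub, map_sum, map_smul, LinearMap.sub_apply, LinearMap.sum_apply,
      LinearMap.smul_apply, LinearMap.zero_apply] at h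
    exact sub_eq_zero.mp h
  have := hV.2.1.1
  have := hW.2.1.1
  obtain ⟨T, hT, hTi⟩ := clif_intertwine (fun i => ψ (brU n B (e i) (e i)) / 2)
    (fun i => V.ρ.act (iU n B (e i))) (fun i => W.ρ.act (iU n B (e i))) W.ρ.P
    (rep_PP n W hW.1) (fun i m => rep_P_odd n W hW.1 (e i) m)
    (hsq V hV) (hac V hV) (hsq W hW) (hac W hW) (hze V hV) (hze W hW)
  change ∀ i m, W.ρ.act (iU n B (e i)) (T m) = T (V.ρ.act (iU n B (e i)) m) at hTi
  obtain ⟨S, hS, ε, hε, hSP, hSi⟩ : ∃ S : V.M →ₗ[ℂ] W.M, S ≠ 0 ∧ ∃ ε : ℂ, ε * ε = 1 ∧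
      (∀ m, W.ρ.P (S m) = ε • S (V.ρ.P m)) ∧
      ∀ i m, W.ρ.act (iU n B (e i)) (S m) = S (V.ρ.act (iU n B (e i)) m) := by
    by_cases hp : T + W.ρ.P ∘ₗ T ∘ₗ V.ρ.P = 0
    · refine ⟨T - W.ρ.P ∘ₗ T ∘ₗ V.ρ.P, ?_, -1, by norm_num, ?_, ?_⟩
      · intro hm
        have h3 : (2 : ℂ) • T = 0 := by
          have := congrArg₂ (· + ·) hp hm
          simp only [add_zero] at this
          rw [← this]; module
        rcases smul_eq_zero.mp h3 with h3 | h3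
        · norm_num at h3
        · exact hT h3
      · intro m
        simp [rep_PP n W hW.1, rep_PP n V hV.1]
      · intro i m
        rw [LinearMap.sub_apply, LinearMap.sub_apply, map_sub, hTi]
        congr 1
        simp only [LinearMap.comp_apply]
        rw [rep_P_odd n V hV.1, map_neg, ← hTi i, map_neg, rep_P_odd n W hW.1, neg_neg]
    · refine ⟨T + W.ρ.P ∘ₗ T ∘ₗ V.ρ.P, hp, 1, by norm_num, ?_, ?_⟩
      · intro m
        simp [rep_PP n W hW.1, rep_PP n V hV.1, add_comm]
      · intro i m
        rw [LinearMap.add_apply, LinearMap.add_apply, map_add, hTi]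
        congr 1
        simp only [LinearMap.comp_apply]
        rw [rep_P_odd n V hV.1, map_neg, ← hTi i, map_neg, rep_P_odd n W hW.1, neg_neg]
  have hSa : ∀ x m, S (V.ρ.act x m) = W.ρ.act x (S m) := by
    intro x m
    rw [rep_split n V x m, rep_split n W x (S m), hsc V hV, hsc W hW, hod V hV, hod W hW,
      map_add, map_smul, map_sum]
    congr 1
    refine Finset.sum_congr rfl fun i _ => ?_
    rw [map_smul, hSi]
  have hSP' : ∀ m, S (V.ρ.P m) = ε • W.ρ.P (S m) := by
    intro m; rw [hSP, smul_smul, hε, one_smul]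
  have hker : LinearMap.ker S = ⊥ := by
    refine (hV.2.1.2 _ ⟨?_, ?_⟩).resolve_right fun h => hS (LinearMap.ker_eq_top.mp h)
    · intro x m hm
      rw [LinearMap.mem_ker] at hm ⊢
      rw [hSa, hm, map_zero]
    · intro m hm
      rw [LinearMap.mem_ker] at hm ⊢
      rw [hSP', hm, map_zero, smul_zero]
  have hran : LinearMap.range S = ⊤ := by
    refine (hW.2.1.2 _ ⟨?_, ?_⟩).resolve_left fun h => hS (LinearMap.range_eq_bot.mp h)
    · rintro x _ ⟨m, rfl⟩
      exact ⟨V.ρ.act x m, hSa x m⟩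
    · rintro _ ⟨m, rfl⟩
      exact ⟨ε • V.ρ.P m, by rw [map_smul, hSP]⟩
  exact ⟨LinearEquiv.ofBijective S ⟨LinearMap.ker_eq_bot.mp hker, LinearMap.range_eq_top.mp hran⟩,
    hSa⟩

lemma even_scalar (V : CartanMod n B) (hr : HAct.IsRep n B V.ρ) (hi : HAct.Irred n B V.ρ)
    (hfd : FiniteDimensional ℂ V.M) :
    ∃ ψ : h0A n B →ₗ[ℂ] ℂ, ∀ x m, V.ρ.act (iE n B x) m = ψ x • m := by
  have := hi.1
  have h1 : ∀ x, ∃ c : ℂ, V.ρ.act (iE n B x) = c • LinearMap.id := by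
    intro x
    obtain ⟨c, hc⟩ := Module.End.exists_eigenvalue (V.ρ.act (iE n B x))
    refine ⟨c, ?_⟩
    have h := (hi.2 (Module.End.eigenspace (V.ρ.act (iE n B x)) c) ⟨?_, ?_⟩).resolve_left hc
    · ext m
      have : m ∈ Module.End.eigenspace (V.ρ.act (iE n B x)) c := by rw [h]; trivial
      exact Module.End.mem_eigenspace_iff.mp this
    · intro y m hm
      rw [Module.End.mem_eigenspace_iff] at hm ⊢
      rw [rep_even_comm n V hr, hm, map_smul]
    · intro m hm
      rw [Module.End.mem_eigenspace_iff] at hm ⊢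
      rw [← rep_P_even n V hr, hm, map_smul]
  refine ⟨((Module.finrank ℂ V.M : ℂ)⁻¹) • (LinearMap.trace ℂ V.M ∘ₗ V.ρ.act ∘ₗ iE n B), ?_⟩
  intro x m
  obtain ⟨c, hc⟩ := h1 x
  have hd : (Module.finrank ℂ V.M : ℂ) ≠ 0 := by
    exact_mod_cast (Module.finrank_pos (R := ℂ) (M := V.M)).ne'
  have : (((Module.finrank ℂ V.M : ℂ)⁻¹) • (LinearMap.trace ℂ V.M ∘ₗ V.ρ.act ∘ₗ iE n B)) x = c := by
    simp only [LinearMap.smul_apply, LinearMap.comp_apply, hc, map_smul, LinearMap.trace_id,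
      smul_eq_mul]
    field_simp
  rw [this, hc]; rfl

/-- The odd element `(E_ii - E_jj) ⊗ a`. -/
def rootU (n : ℕ) (B : Type) [CommRing B] [Algebra ℂ B] (i j : Fin (n + 1)) :
    B →ₗ[ℂ] hU n B where
  toFun a := ⟨Matrix.diagonal (Pi.single i a - Pi.single j a),
    ⟨Matrix.isDiag_diagonal _, by simp [Matrix.trace_diagonal, Finset.sum_sub_distrib]⟩⟩
  map_add' a b := by
    apply Subtype.ext
    simp only [Submodule.coe_add, Matrix.diagonal_add]
    congr 1; ext k; simp [Pi.single_add]; ring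
  map_smul' c a := by
    apply Subtype.ext
    simp only [Submodule.coe_smul, RingHom.id_apply, ← Matrix.diagonal_smul]
    congr 1; ext k; simp [Pi.single_smul, smul_sub]

lemma brM_root (i j k : Fin (n + 1)) (hij : i ≠ j) (hik : i ≠ k) (hjk : j ≠ k) (a b : B) :
    brM n B (rootU n B i j a) (rootU n B i k b) =
      (2 : ℂ) • (Matrix.diagonal (Pi.single i (a * b)) -
        (((n : ℂ) + 1)⁻¹ • (a * b)) • (1 : QMat n B)) := by
  have h : (rootU n B i j a : QMat n B) * rootU n B i k b = Matrix.diagonal (Pi.single i (a * b)) := by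
    show Matrix.diagonal _ * Matrix.diagonal _ = _
    rw [Matrix.diagonal_mul_diagonal]
    congr 1; ext l
    simp only [Pi.sub_apply, Pi.single_apply]
    by_cases h1 : l = i
    · subst h1; simp [hij, hik]
    · by_cases h2 : l = j
      · subst h2; simp [h1, hjk]
      · simp [h1, h2]
  have h' : (rootU n B i k b : QMat n B) * rootU n B i j a = Matrix.diagonal (Pi.single i (a * b)) := by
    rw [← h]; exact diag_comm n (rootU n B i k b).2.1 (rootU n B i j a).2.1
  rw [brM, h, h', ← two_smul ℂ, Matrix.trace_smul, Matrix.trace_diagonal, smul_sub,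
    smul_comm _ (2 : ℂ), smul_assoc (2 : ℂ)]
  simp

lemma part_LFun (hn : 2 ≤ n) (V : CartanMod n B) (hr : HAct.IsRep n B V.ρ)
    (hi : HAct.Irred n B V.ρ) (hfd : FiniteDimensional ℂ V.M) (ψ : h0A n B →ₗ[ℂ] ℂ)
    (hψ : ∀ x m, V.ρ.act (iE n B x) m = ψ x • m) : LFun n B ψ := by
  have := hi.1
  obtain ⟨v, hv⟩ := exists_ne (0 : V.M)
  let F : B →ₗ[ℂ] (Fin (n+1) → Fin (n+1) → V.M →ₗ[ℂ] V.M) :=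
    LinearMap.pi fun i => LinearMap.pi fun j => V.ρ.act ∘ₗ iU n B ∘ₗ rootU n B i j
  let K := LinearMap.ker F
  let I : Ideal B := Ideal.span (K : Set B)
  have hK : FiniteDimensional ℂ (B ⧸ K) :=
    FiniteDimensional.of_injective (F.quotKerEquivRange.toLinearMap) (LinearEquiv.injective _)
  have hKI : K ≤ LinearMap.ker (Ideal.Quotient.mkₐ ℂ I).toLinearMap := by
    intro a ha
    exact Ideal.Quotient.eq_zero_iff_mem.mpr (Ideal.subset_span ha)
  refine ⟨I, ?_, ?_⟩
  · refine Module.Finite.of_surjective (K.liftQ _ hKI) ?_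
    intro y
    obtain ⟨b, rfl⟩ := Ideal.Quotient.mk_surjective y
    exact ⟨K.mkQ b, rfl⟩
  have hex : ∀ i : Fin (n+1), ∃ j k : Fin (n+1), i ≠ j ∧ i ≠ k ∧ j ≠ k := by
    intro i
    have h2 : 2 ≤ ({i}ᶜ : Finset (Fin (n+1))).card := by
      rw [Finset.card_compl]; simp; omega
    obtain ⟨j, hj, k, hk, hjk⟩ := Finset.one_lt_card.mp h2
    simp only [Finset.mem_compl, Finset.mem_singleton] at hj hk
    exact ⟨j, k, Ne.symm hj, Ne.symm hk, hjk⟩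
  choose j k hij hik hjk using hex
  have hvan : ∀ i, ∀ a ∈ I, ∀ b, ψ (brU n B (rootU n B i (j i) a) (rootU n B i (k i) b)) = 0 := by
    intro i a ha
    induction ha using Submodule.span_induction with
    | mem a ha =>
      intro b
      have h0 : V.ρ.act (iU n B (rootU n B i (j i) a)) = 0 :=
        congrFun (congrFun (LinearMap.mem_ker.mp ha) i) (j i)
      have h := rep_odd n V hr (rootU n B i (j i) a) (rootU n B i (k i) b) v
      rw [h0, hψ] at h
      simp only [LinearMap.zero_apply, map_zero, add_zero] at h
      exact (smul_eq_zero.mp h.symm).resolve_right hv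
    | zero => intro b; simp
    | add x y _ _ hx hy => intro b; simp [hx, hy]
    | smul c x _ hx =>
      intro b
      rw [← hx (c * b)]
      congr 1
      apply Subtype.ext
      apply Prod.ext
      · show brM n B _ _ = brM n B _ _
        rw [brM_root n _ _ _ (hij i) (hik i) (hjk i), brM_root n _ _ _ (hij i) (hik i) (hjk i)]
        have : c • x * b = x * (c * b) := by rw [smul_eq_mul]; ring
        rw [this]
      · rfl
  intro x hx
  have hsum : x = ∑ i, (2⁻¹ : ℂ) •
      brU n B (rootU n B i (j i) (x.1.1 i i)) (rootU n B i (k i) 1) := by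
    apply Subtype.ext
    rw [AddSubmonoidClass.coe_finsetSum]
    apply Prod.ext
    · rw [Prod.fst_sum]
      have hterm : ∀ i, (((2⁻¹ : ℂ) • brU n B (rootU n B i (j i) (x.1.1 i i))
          (rootU n B i (k i) 1) : h0A n B) : QPair n B).1 =
          Matrix.diagonal (Pi.single i (x.1.1 i i)) -
            (((n : ℂ) + 1)⁻¹ • (x.1.1 i i)) • (1 : QMat n B) := by
        intro i
        show (2⁻¹ : ℂ) • brM n B _ _ = _
        rw [brM_root n _ _ _ (hij i) (hik i) (hjk i), smul_smul, mul_one]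
        norm_num
      rw [Finset.sum_congr rfl fun i _ => hterm i, Finset.sum_sub_distrib, ← Finset.sum_smul,
        ← Finset.smul_sum]
      have htr : ∑ i, x.1.1 i i = 0 := x.2.2.2
      rw [htr, smul_zero, zero_smul, sub_zero]
      ext a b
      rw [Matrix.sum_apply]
      by_cases hab : a = b
      · subst hab
        simp [Pi.single_apply]
      · rw [x.2.2.1 hab]
        simp [hab]
    · rw [Prod.snd_sum]
      rw [x.2.1]
      exact (Finset.sum_eq_zero fun i _ => by
        show (2⁻¹ : ℂ) • (0 : QMat n B) = 0
        simp).symm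
  rw [hsum, map_sum]
  refine Finset.sum_eq_zero fun i _ => ?_
  rw [map_smul, hvan i _ (hx i i).1, smul_zero]

end CartanHelpers

/-- Classification of the irreducible finite-dimensional modules of the Cartan
subalgebra `𝔥 ⊗ A` of `𝔮(n) ⊗ A`, `n ≥ 2`: for each `ψ ∈ 𝓛(𝔥 ⊗ A)` there is an
irreducible finite-dimensional `𝔥 ⊗ A`-module `H(ψ)` on which `𝔥₀ ⊗ A` acts via `ψ`;
it is unique up to isomorphism; and every irreducible finite-dimensional
`𝔥 ⊗ A`-module is of this form for a unique `ψ ∈ 𝓛(𝔥 ⊗ A)`.  In other words,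
`ψ ↦ H(ψ)` is a bijection from `𝓛(𝔥 ⊗ A)` onto the set of isomorphism classes of
irreducible finite-dimensional `𝔥 ⊗ A`-modules. -/
theorem cartan_module_classification (hn : 2 ≤ n) :
    (∀ ψ : ↥(h0A n B) →ₗ[ℂ] ℂ, LFun n B ψ → ∃ V : CartanMod n B, IsHpsi n V ψ) ∧
    (∀ (ψ : ↥(h0A n B) →ₗ[ℂ] ℂ), LFun n B ψ →
      ∀ V W : CartanMod n B, IsHpsi n V ψ → IsHpsi n W ψ → HModIso n V W) ∧
    (∀ V : CartanMod n B, HAct.IsRep n B V.ρ → HAct.Irred n B V.ρ →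
      FiniteDimensional ℂ V.M →
      ∃! ψ : ↥(h0A n B) →ₗ[ℂ] ℂ, LFun n B ψ ∧ IsHpsi n V ψ) := by
  refine ⟨part_exist n, part_unique n, ?_⟩
  intro V hr hi hfd
  obtain ⟨ψ, hψ⟩ := even_scalar n V hr hi hfd
  refine ⟨ψ, ⟨part_LFun n hn V hr hi hfd ψ hψ, hr, hi, hfd, ?_⟩, ?_⟩
  · intro p hp
    ext m
    exact hψ ⟨p, hp⟩ m
  · rintro φ ⟨-, -, -, -, hφ⟩
    have := hi.1
    obtain ⟨v, hv⟩ := exists_ne (0 : V.M)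
    ext x
    have h1 : φ x • v = ψ x • v := by
      rw [← hψ x v]
      exact (LinearMap.congr_fun (hφ x.1 x.2) v).symm
    exact smul_left_injective ℂ hv h1
end
end

section
/- Let $\psi \in \mathcal{L}(\mathfrak{h} \otimes A)$ and let $I$ be an ideal of $A$. Then $\psi(\mathfrak{h}_{\bar 0} \otimes I) = 0$ if and only if $(\mathfrak{q} \otimes I)V(\psi) = 0$, where $V(\psi)$ is the irreducible highest weight $\mathfrak{q} \otimes A$-module of highest weight $\psi$. -/
open Matrix

noncomputable section

variable (n : ℕ) (A : Type*) [CommRing A] [Algebra ℂ A]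

variable {M : Type*} [AddCommGroup M] [Module ℂ M]

section Helpers

lemma qbr_add_left (p p' q : QPair n A) :
    qbr n A (p + p') q = qbr n A p q + qbr n A p' q := by
  ext i j <;> simp [qbr, add_mul, mul_add, add_smul] <;> ring

lemma qbr_add_right (p q q' : QPair n A) :
    qbr n A p (q + q') = qbr n A p q + qbr n A p q' := by
  ext i j <;> simp [qbr, add_mul, mul_add, add_smul] <;> ring

/-- even part -/
def evq (x : ↥(qA n A)) : ↥(qA n A) := ⟨(x.1.1, 0), ⟨x.2.1, by simp⟩⟩
/-- odd part -/
def odq (x : ↥(qA n A)) : ↥(qA n A) := ⟨(0, x.1.2), ⟨by simp, x.2.2⟩⟩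
/-- parity automorphism -/
def sgq (x : ↥(qA n A)) : ↥(qA n A) :=
  ⟨(x.1.1, -x.1.2), ⟨x.2.1, by have := x.2.2; simp [this]⟩⟩
/-- bracket in `qA` -/
def brq (x y : ↥(qA n A)) : ↥(qA n A) := ⟨qbr n A x y, qbr_mem n A _ _⟩

lemma ev_add_od (x : ↥(qA n A)) : evq n A x + odq n A x = x := by
  apply Subtype.ext; simp [evq, odq]

lemma sgq_eq (x : ↥(qA n A)) : sgq n A x = evq n A x - odq n A x := by
  apply Subtype.ext; simp [evq, odq, sgq]

lemma brq_add_left (x x' y : ↥(qA n A)) :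
    brq n A (x + x') y = brq n A x y + brq n A x' y :=
  Subtype.ext (qbr_add_left n A _ _ _)

lemma brq_add_right (x y y' : ↥(qA n A)) :
    brq n A x (y + y') = brq n A x y + brq n A x y' :=
  Subtype.ext (qbr_add_right n A _ _ _)

lemma comm_formula (ρ : QAct n A M) (hrep : QAct.IsRep n A ρ) (z f : ↥(qA n A)) (m : M) :
    ρ.act z (ρ.act f m) = ρ.act (brq n A z f) m + ρ.act f (ρ.act (evq n A z) m)
      + ρ.act (sgq n A f) (ρ.act (odq n A z) m) := by
  obtain ⟨-, -, -, h4, h5⟩ := hrep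
  have e1 := LinearMap.congr_fun (h4 (evq n A z) (evq n A f) (Or.inl rfl)) m
  have e2 := LinearMap.congr_fun (h4 (evq n A z) (odq n A f) (Or.inl rfl)) m
  have e3 := LinearMap.congr_fun (h4 (odq n A z) (evq n A f) (Or.inr rfl)) m
  have e4 := LinearMap.congr_fun (h5 (odq n A z) (odq n A f) rfl rfl) m
  have hb : brq n A z f = brq n A (evq n A z) (evq n A f) + brq n A (evq n A z) (odq n A f)
      + brq n A (odq n A z) (evq n A f) + brq n A (odq n A z) (odq n A f) := by
    conv_lhs => rw [← ev_add_od n A z, ← ev_add_od n A f]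
    rw [brq_add_left, brq_add_right, brq_add_right]; abel
  rw [hb, sgq_eq]
  conv_lhs => rw [← ev_add_od n A z, ← ev_add_od n A f]
  have hf : ρ.act f = ρ.act (evq n A f) + ρ.act (odq n A f) := by
    rw [← map_add, ev_add_od]
  rw [hf]
  simp only [map_add, map_sub, LinearMap.add_apply, LinearMap.sub_apply]
  simp only [LinearMap.add_apply, LinearMap.sub_apply, LinearMap.comp_apply] at e1 e2 e3 e4
  change ρ.act (brq n A _ _) m = _ at e1
  change ρ.act (brq n A _ _) m = _ at e2
  change ρ.act (brq n A _ _) m = _ at e3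
  change ρ.act (brq n A _ _) m = _ at e4
  rw [e1, e2, e3, e4]
  abel

lemma P_formula (ρ : QAct n A M) (hrep : QAct.IsRep n A ρ) (z : ↥(qA n A)) (m : M) :
    ρ.act z (ρ.P m) = ρ.P (ρ.act (sgq n A z) m) := by
  obtain ⟨-, h2, h3, -, -⟩ := hrep
  have e1 := LinearMap.congr_fun (h2 (evq n A z) rfl) m
  have e2 := LinearMap.congr_fun (h3 (odq n A z) rfl) m
  rw [sgq_eq]
  conv_lhs => rw [← ev_add_od n A z]
  simp only [map_add, map_sub, LinearMap.add_apply, LinearMap.sub_apply]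
  simp only [LinearMap.neg_apply, LinearMap.comp_apply] at e1 e2
  rw [e1, e2]; abel

lemma sg_sg (z : ↥(qA n A)) : sgq n A (sgq n A z) = z := by
  apply Subtype.ext; simp [sgq]

lemma P_formula' (ρ : QAct n A M) (hrep : QAct.IsRep n A ρ) (z : ↥(qA n A)) (m : M) :
    ρ.P (ρ.act z m) = ρ.act (sgq n A z) (ρ.P m) := by
  rw [P_formula n A ρ hrep, sg_sg]

/-- strictly lower triangular -/
def InNm (p : QPair n A) : Prop :=
  ∀ i j : Fin (n + 1), i ≤ j → p.1 i j = 0 ∧ p.2 i j = 0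

open Classical in
/-- entries on selected diagonals -/
def mk1 (s : ℤ → Prop) (X : QMat n A) : QMat n A :=
  Matrix.of fun i j => if s ((i : ℤ) - (j : ℤ)) then X i j else 0

lemma mk1_trace (s : ℤ → Prop) (X : QMat n A) (h : X.trace = 0) : (mk1 n A s X).trace = 0 := by
  by_cases h0 : s 0
  · simpa [mk1, Matrix.trace, h0] using h
  · simp [mk1, Matrix.trace, h0]

/-- selected diagonals part -/
def mkq (s : ℤ → Prop) (x : ↥(qA n A)) : ↥(qA n A) :=
  ⟨(mk1 n A s x.1.1, mk1 n A s x.1.2), ⟨mk1_trace n A s _ x.2.1, mk1_trace n A s _ x.2.2⟩⟩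

lemma mkq_entry1 (s : ℤ → Prop) (x : ↥(qA n A)) (i j : Fin (n+1)) (h : s ((i:ℤ) - j)) :
    (mkq n A s x).1.1 i j = x.1.1 i j ∧ (mkq n A s x).1.2 i j = x.1.2 i j := by
  simp [mkq, mk1, h]

lemma mkq_entry0 (s : ℤ → Prop) (x : ↥(qA n A)) (i j : Fin (n+1)) (h : ¬ s ((i:ℤ) - j)) :
    (mkq n A s x).1.1 i j = 0 ∧ (mkq n A s x).1.2 i j = 0 := by
  simp [mkq, mk1, h]

lemma mkq_entriesIn (I : Ideal A) (s : ℤ → Prop) (x : ↥(qA n A)) (h : EntriesIn n A I x.1) :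
    EntriesIn n A I (mkq n A s x).1 := by
  intro i j
  by_cases hs : s ((i:ℤ) - j)
  · rw [(mkq_entry1 n A s x i j hs).1, (mkq_entry1 n A s x i j hs).2]; exact h i j
  · rw [(mkq_entry0 n A s x i j hs).1, (mkq_entry0 n A s x i j hs).2]; simp

lemma tri_decomp (x : ↥(qA n A)) :
    x = mkq n A (fun r => 0 < r) x + mkq n A (fun r => r = 0) x + mkq n A (fun r => r < 0) x := by
  apply Subtype.ext
  ext i j <;> simp [mkq, mk1] <;> rcases lt_trichotomy i j with h | h | h <;>
    grind

lemma neg_decomp (x : ↥(qA n A)) (hx : InNm n A x.1) :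
    x = ∑ r ∈ Finset.range n, mkq n A (fun t => t = (r : ℤ) + 1) x := by
  have key : ∀ X : QMat n A, (∀ i j, i ≤ j → X i j = 0) →
      X = ∑ r ∈ Finset.range n, mk1 n A (fun t => t = (r : ℤ) + 1) X := by
    intro X hX
    ext i j
    simp only [Matrix.sum_apply, mk1, Matrix.of_apply]
    by_cases hij : i ≤ j
    · simp [hX i j hij]
    · push Not at hij
      rw [Finset.sum_eq_single ((i:ℕ) - j - 1)]
      · rw [if_pos]; omega
      · intro b _ hb; rw [if_neg]; omega
      · intro h; simp at h; omega
  apply Subtype.ext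
  rw [AddSubmonoidClass.coe_finsetSum]
  apply Prod.ext
  · rw [Prod.fst_sum]; exact key _ fun i j h => (hx i j h).1
  · rw [Prod.snd_sum]; exact key _ fun i j h => (hx i j h).2

lemma mk_pos (x : ↥(qA n A)) : InNm n A (mkq n A (fun r => 0 < r) x).1 :=
  fun i j h => mkq_entry0 n A _ x i j (by simp; omega)

lemma mk_neg (x : ↥(qA n A)) : InNplus n A (mkq n A (fun r => r < 0) x).1 :=
  fun i j h => mkq_entry0 n A _ x i j (by simp; omega)

lemma mk_zero (x : ↥(qA n A)) : InH n A (mkq n A (fun r => r = 0) x).1 :=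
  ⟨fun i j h => (mkq_entry0 n A _ x i j (by omega)).1,
   fun i j h => (mkq_entry0 n A _ x i j (by omega)).2⟩

lemma sg_Nm (x : ↥(qA n A)) (h : InNm n A x.1) : InNm n A (sgq n A x).1 :=
  fun i j hij => ⟨(h i j hij).1, by simp [sgq, (h i j hij).2]⟩
lemma sg_Np (x : ↥(qA n A)) (h : InNplus n A x.1) : InNplus n A (sgq n A x).1 :=
  fun i j hij => ⟨(h i j hij).1, by simp [sgq, (h i j hij).2]⟩
lemma ev_Np (x : ↥(qA n A)) (h : InNplus n A x.1) : InNplus n A (evq n A x).1 :=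
  fun i j hij => ⟨(h i j hij).1, by simp [evq]⟩
lemma od_Np (x : ↥(qA n A)) (h : InNplus n A x.1) : InNplus n A (odq n A x).1 :=
  fun i j hij => ⟨by simp [odq], (h i j hij).2⟩

/-- Submodule generation lemma. -/
lemma lemA (ρ : QAct n A M) (hrep : QAct.IsRep n A ρ) (hirr : QAct.Irred n A ρ)
    (K L : Submodule ℂ M)
    (h1 : ∀ z : ↥(qA n A), InNplus n A z.1 → ∀ w ∈ K, ρ.act z w = 0)
    (h2 : ∀ z : ↥(qA n A), InH n A z.1 → ∀ w ∈ K, ρ.act z w ∈ K)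
    (h3 : ∀ w ∈ K, ρ.P w ∈ K)
    (h4 : ∀ z : ↥(qA n A), InNm n A z.1 → ∀ w ∈ K, ρ.act z w ∈ L)
    (h5 : ∀ z : ↥(qA n A), InNm n A z.1 → ∀ w ∈ L, ρ.act z w ∈ L) :
    K = ⊥ ∨ K ⊔ L = ⊤ := by
  let S : Set (Submodule ℂ M) :=
    {N | K ≤ N ∧ ∀ y : ↥(qA n A), InNm n A y.1 → ∀ m ∈ N, ρ.act y m ∈ N}
  let R : Submodule ℂ M := sInf S
  have hKR : K ≤ R := le_sInf fun N hN => hN.1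
  have hRy : ∀ y : ↥(qA n A), InNm n A y.1 → ∀ m ∈ R, ρ.act y m ∈ R := by
    intro y hy m hm
    rw [Submodule.mem_sInf] at hm ⊢
    intro N hN
    exact hN.2 y hy m (hm N hN)
  have hRmin : ∀ N ∈ S, R ≤ N := fun N hN => sInf_le hN
  have hinv : QAct.Invt n A ρ R := by
    constructor
    · let Q : Submodule ℂ M := R ⊓ ⨅ z : ↥(qA n A), R.comap (ρ.act z)
      have hQ : R ≤ Q := by
        apply hRmin
        refine ⟨le_inf hKR (le_iInf fun z w hw => ?_), ?_⟩
        · rw [Submodule.mem_comap, tri_decomp n A z]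
          simp only [map_add, LinearMap.add_apply]
          refine R.add_mem (R.add_mem ?_ ?_) ?_
          · exact hRy _ (mk_pos n A z) _ (hKR hw)
          · exact hKR (h2 _ (mk_zero n A z) _ hw)
          · rw [h1 _ (mk_neg n A z) _ hw]; exact R.zero_mem
        · rintro y hy m ⟨hm1, hm2⟩
          have hm2' : ∀ z, ρ.act z m ∈ R := fun z => by
            have := (Submodule.mem_iInf _).1 hm2 z
            exact this
          refine ⟨hRy y hy m hm1, (Submodule.mem_iInf _).2 fun z => ?_⟩
          rw [Submodule.mem_comap, comm_formula n A ρ hrep]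
          exact R.add_mem (R.add_mem (hm2' _) (hRy _ hy _ (hm2' _)))
            (hRy _ (sg_Nm n A _ hy) _ (hm2' _))
      intro z m hm
      exact (Submodule.mem_iInf _).1 (hQ hm).2 z
    · have hQ : R ≤ R ⊓ R.comap ρ.P := by
        apply hRmin
        refine ⟨le_inf hKR fun w hw => hKR (h3 w hw), ?_⟩
        rintro y hy m ⟨hm1, hm2⟩
        refine ⟨hRy y hy m hm1, ?_⟩
        change ρ.P (ρ.act y m) ∈ R
        rw [P_formula' n A ρ hrep]
        exact hRy _ (sg_Nm n A _ hy) _ hm2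
      intro m hm
      exact (hQ hm).2
  rcases hirr.2 R hinv with h | h
  · left; rw [eq_bot_iff, ← h]; exact hKR
  · right
    rw [eq_top_iff, ← h]
    apply hRmin
    refine ⟨le_sup_left, fun y hy m hm => ?_⟩
    obtain ⟨a, ha, b, hb, rfl⟩ := Submodule.mem_sup.1 hm
    rw [map_add]
    exact Submodule.mem_sup_right (L.add_mem (h4 y hy a ha) (h5 y hy b hb))

/-- grading matrix -/
def dmat : QMat n A := Matrix.diagonal fun i => algebraMap ℂ A ((n : ℂ)/2 - (i : ℕ))

lemma dmat_mem : ((dmat n A, 0) : QPair n A) ∈ h0A n A := by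
  refine ⟨rfl, Matrix.isDiag_diagonal _, ?_⟩
  have h : ∑ i : Fin (n+1), ((n : ℂ)/2 - (i : ℕ)) = 0 := by
    rw [Finset.sum_sub_distrib, Fin.sum_univ_eq_sum_range (fun i => (i : ℂ)) (n+1)]
    have := Finset.sum_range_id_mul_two (n+1)
    have h' : (∑ i ∈ Finset.range (n+1), (i:ℂ)) * 2 = (n+1) * n := by
      rw [Nat.add_sub_cancel] at this
      have h2 := congrArg (Nat.cast : ℕ → ℂ) this
      push_cast at h2
      exact h2
    simp
    linear_combination -(1/2) * h'
  simp only [dmat, Matrix.trace_diagonal]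
  rw [← map_sum, h, map_zero]

/-- grading element -/
def dq : ↥(qA n A) := ⟨(dmat n A, 0), h0A_le_qA n A (dmat_mem n A)⟩

lemma br_dq (r : ℤ) (y : ↥(qA n A))
    (hy : ∀ i j : Fin (n+1), (i:ℤ) - j ≠ r → y.1.1 i j = 0 ∧ y.1.2 i j = 0) :
    brq n A (dq n A) y = (-(r:ℂ)) • y := by
  have key : ∀ X : QMat n A, (∀ i j : Fin (n+1), (i:ℤ) - j ≠ r → X i j = 0) →
      dmat n A * X - X * dmat n A = (-(r:ℂ)) • X := by
    intro X hX
    ext i j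
    simp only [dmat, Matrix.sub_apply, Matrix.diagonal_mul, Matrix.mul_diagonal, Matrix.smul_apply]
    by_cases h : (i:ℤ) - j = r
    · subst h
      rw [Algebra.smul_def]
      have e : (-(((i:ℤ) - (j:ℤ) : ℤ) : ℂ)) = ((n : ℂ)/2 - (i : ℕ)) - ((n : ℂ)/2 - (j : ℕ)) := by
        push_cast; ring
      rw [e, map_sub (algebraMap ℂ A) ((n : ℂ)/2 - (i : ℕ)), sub_mul, mul_comm (X i j)]
    · simp [hX i j h]
  apply Subtype.ext
  apply Prod.ext
  · have := key y.1.1 fun i j h => (hy i j h).1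
    simpa [brq, qbr, dq] using this
  · have := key y.1.2 fun i j h => (hy i j h).2
    simpa [brq, qbr, dq] using this

lemma ev_dq : evq n A (dq n A) = dq n A := rfl
lemma od_dq : odq n A (dq n A) = 0 := rfl

lemma eig_shift (ρ : QAct n A M) (hrep : QAct.IsRep n A ρ) (r : ℤ) (y : ↥(qA n A))
    (hy : ∀ i j : Fin (n+1), (i:ℤ) - j ≠ r → y.1.1 i j = 0 ∧ y.1.2 i j = 0)
    (μ : ℂ) (m : M) (hm : m ∈ Module.End.eigenspace (ρ.act (dq n A)) μ) :
    ρ.act y m ∈ Module.End.eigenspace (ρ.act (dq n A)) (μ - r) := by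
  rw [Module.End.mem_eigenspace_iff] at hm ⊢
  rw [comm_formula n A ρ hrep, br_dq n A r y hy, ev_dq, od_dq, hm]
  simp only [map_smul, LinearMap.smul_apply, map_zero, LinearMap.zero_apply, add_zero]
  module

/-- lower part -/
def Low (ρ : QAct n A M) (c : ℂ) : Submodule ℂ M :=
  ⨆ k : ℕ, Module.End.eigenspace (ρ.act (dq n A)) (c - ((k : ℂ) + 1))

lemma low_disj (ρ : QAct n A M) (c : ℂ) :
    Disjoint (Module.End.eigenspace (ρ.act (dq n A)) c) (Low n A ρ c) := by
  refine (Module.End.eigenspaces_iSupIndep (ρ.act (dq n A)) c).mono_right ?_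
  refine iSup_le fun k => ?_
  refine le_iSup₂_of_le (c - ((k : ℂ) + 1)) ?_ le_rfl
  intro h
  have : ((k:ℂ) + 1) = 0 := by linear_combination -h
  exact Nat.cast_add_one_ne_zero k this

lemma nm_eig (ρ : QAct n A M) (hrep : QAct.IsRep n A ρ) (c : ℂ) (k : ℕ)
    (z : ↥(qA n A)) (hz : InNm n A z.1) (m : M)
    (hm : m ∈ Module.End.eigenspace (ρ.act (dq n A)) (c - k)) :
    ρ.act z m ∈ Low n A ρ c := by
  rw [neg_decomp n A z hz, map_sum, LinearMap.sum_apply]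
  refine Submodule.sum_mem _ fun r _ => ?_
  refine Submodule.mem_iSup_of_mem (k + r) ?_
  have := eig_shift n A ρ hrep ((r:ℤ)+1) (mkq n A (fun t => t = (r : ℤ) + 1) z)
    (fun i j h => mkq_entry0 n A _ z i j h) _ m hm
  convert this using 2
  push_cast; ring

lemma nm_low (ρ : QAct n A M) (hrep : QAct.IsRep n A ρ) (c : ℂ)
    (z : ↥(qA n A)) (hz : InNm n A z.1) (m : M) (hm : m ∈ Low n A ρ c) :
    ρ.act z m ∈ Low n A ρ c := by
  have : Low n A ρ c ≤ (Low n A ρ c).comap (ρ.act z) := by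
    conv_lhs => rw [Low]
    refine iSup_le fun k w hw => ?_
    refine nm_eig n A ρ hrep c (k+1) z hz w ?_
    convert hw using 2
    push_cast; ring
  exact this hm

lemma diag_mul_apply {X : QMat n A} (hX : X.IsDiag) (Y : QMat n A) (i j : Fin (n+1)) :
    (X * Y) i j = X i i * Y i j := by
  obtain ⟨d, rfl⟩ : ∃ d, X = Matrix.diagonal d := ⟨_, (hX.diagonal_diag).symm⟩
  simp [Matrix.diagonal_mul]

lemma mul_diag_apply {X : QMat n A} (hX : X.IsDiag) (Y : QMat n A) (i j : Fin (n+1)) :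
    (Y * X) i j = Y i j * X j j := by
  obtain ⟨d, rfl⟩ : ∃ d, X = Matrix.diagonal d := ⟨_, (hX.diagonal_diag).symm⟩
  simp [Matrix.mul_diagonal]

lemma br_Np_H (z h : ↥(qA n A)) (hz : InNplus n A z.1) (hh : InH n A h.1) :
    InNplus n A (brq n A z h).1 := by
  have ht : (z.1.2 * h.1.2 + h.1.2 * z.1.2).trace = 0 := by
    rw [Matrix.trace]
    refine Finset.sum_eq_zero fun i _ => ?_
    rw [Matrix.diag_apply, Matrix.add_apply, diag_mul_apply n A hh.2, mul_diag_apply n A hh.2,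
      (hz i i le_rfl).2]
    simp
  intro i j hij
  simp only [brq, qbr, ht]
  simp [diag_mul_apply n A hh.2, mul_diag_apply n A hh.2, diag_mul_apply n A hh.1,
    mul_diag_apply n A hh.1, hz i j hij]

lemma Np_H (ρ : QAct n A M) (hrep : QAct.IsRep n A ρ) (w : M)
    (hw : ∀ z : ↥(qA n A), InNplus n A z.1 → ρ.act z w = 0)
    (h : ↥(qA n A)) (hh : InH n A h.1)
    (z : ↥(qA n A)) (hz : InNplus n A z.1) : ρ.act z (ρ.act h w) = 0 := by
  rw [comm_formula n A ρ hrep, hw _ (br_Np_H n A z h hz hh), hw _ (ev_Np n A z hz),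
    hw _ (od_Np n A z hz)]
  simp

lemma br_h0_H (p h : ↥(qA n A)) (hp : InH0 n A p.1) (hh : InH n A h.1) :
    brq n A p h = 0 := by
  apply Subtype.ext
  ext i j <;> simp [brq, qbr, hp.1, diag_mul_apply n A hp.2, mul_diag_apply n A hp.2]
  · by_cases e : i = j
    · subst e; ring
    · simp [hh.1 e]
  · by_cases e : i = j
    · subst e; ring
    · simp [hh.2 e]

lemma h0_H (ρ : QAct n A M) (hrep : QAct.IsRep n A ρ) (w : M)
    (p h : ↥(qA n A)) (hp : InH0 n A p.1) (hh : InH n A h.1) :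
    ρ.act p (ρ.act h w) = ρ.act h (ρ.act p w) := by
  have e1 : evq n A p = p := Subtype.ext (Prod.ext rfl hp.1.symm)
  have e2 : odq n A p = 0 := Subtype.ext (Prod.ext rfl hp.1)
  rw [comm_formula n A ρ hrep, br_h0_H n A p h hp hh, e1, e2]
  simp

lemma br_entriesIn (I : Ideal A) (z x : ↥(qA n A)) (hx : EntriesIn n A I x.1) :
    EntriesIn n A I (brq n A z x).1 := by
  have l : ∀ X Y : QMat n A, (∀ i j, Y i j ∈ I) → ∀ i j, (X * Y) i j ∈ I := by
    intro X Y hY i j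
    rw [Matrix.mul_apply]
    exact I.sum_mem fun k _ => I.mul_mem_left _ (hY _ _)
  have r : ∀ X Y : QMat n A, (∀ i j, Y i j ∈ I) → ∀ i j, (Y * X) i j ∈ I := by
    intro X Y hY i j
    rw [Matrix.mul_apply]
    exact I.sum_mem fun k _ => I.mul_mem_right _ (hY _ _)
  have h1 : ∀ i j, x.1.1 i j ∈ I := fun i j => (hx i j).1
  have h2 : ∀ i j, x.1.2 i j ∈ I := fun i j => (hx i j).2
  intro i j
  constructor
  · simp only [brq, qbr, Matrix.sub_apply, Matrix.add_apply, Matrix.smul_apply]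
    refine I.sub_mem (I.add_mem (I.add_mem (I.sub_mem (l _ _ h1 i j) (r _ _ h1 i j))
      (l _ _ h2 i j)) (r _ _ h2 i j)) ?_
    rw [smul_eq_mul]
    apply I.mul_mem_right
    rw [Algebra.smul_def]
    apply I.mul_mem_left
    exact I.sum_mem fun k _ => I.add_mem (l _ _ h2 k k) (r _ _ h2 k k)
  · simp only [brq, qbr, Matrix.sub_apply, Matrix.add_apply]
    exact I.sub_mem (I.add_mem (I.sub_mem (l _ _ h2 i j) (r _ _ h2 i j)) (l _ _ h1 i j))
      (r _ _ h1 i j)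

lemma br_entriesIn' (I : Ideal A) (z x : ↥(qA n A)) (hx : EntriesIn n A I x.1) :
    EntriesIn n A I (brq n A x z).1 := by
  have l : ∀ X Y : QMat n A, (∀ i j, Y i j ∈ I) → ∀ i j, (X * Y) i j ∈ I := by
    intro X Y hY i j
    rw [Matrix.mul_apply]
    exact I.sum_mem fun k _ => I.mul_mem_left _ (hY _ _)
  have r : ∀ X Y : QMat n A, (∀ i j, Y i j ∈ I) → ∀ i j, (Y * X) i j ∈ I := by
    intro X Y hY i j
    rw [Matrix.mul_apply]
    exact I.sum_mem fun k _ => I.mul_mem_right _ (hY _ _)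
  have h1 : ∀ i j, x.1.1 i j ∈ I := fun i j => (hx i j).1
  have h2 : ∀ i j, x.1.2 i j ∈ I := fun i j => (hx i j).2
  intro i j
  constructor
  · simp only [brq, qbr, Matrix.sub_apply, Matrix.add_apply, Matrix.smul_apply]
    refine I.sub_mem (I.add_mem (I.add_mem (I.sub_mem (r _ _ h1 i j) (l _ _ h1 i j))
      (r _ _ h2 i j)) (l _ _ h2 i j)) ?_
    rw [smul_eq_mul]
    apply I.mul_mem_right
    rw [Algebra.smul_def]
    apply I.mul_mem_left
    exact I.sum_mem fun k _ => I.add_mem (r _ _ h2 k k) (l _ _ h2 k k)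
  · simp only [brq, qbr, Matrix.sub_apply, Matrix.add_apply]
    exact I.sub_mem (I.add_mem (I.sub_mem (r _ _ h1 i j) (l _ _ h1 i j)) (r _ _ h2 i j))
      (l _ _ h2 i j)


lemma br_h1_H (x h : ↥(qA n A)) (hx : InH1 n A x.1) (hh : InH n A h.1) :
    (brq n A x h).1 ∈ h0A n A := by
  refine ⟨?_, ?_, (brq n A x h).2.1⟩
  · ext i j
    simp [brq, qbr, hx.1, diag_mul_apply n A hx.2, mul_diag_apply n A hx.2]
    by_cases e : i = j
    · subst e; ring
    · simp [hh.1 e]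
  · intro i j e
    simp [brq, qbr, hx.1, diag_mul_apply n A hx.2, mul_diag_apply n A hx.2, hh.2 e,
      Matrix.one_apply_ne e]

lemma step1 (ρ : QAct n A M) (hrep : QAct.IsRep n A ρ) (hirr : QAct.Irred n A ρ)
    (ψ : ↥(h0A n A) →ₗ[ℂ] ℂ) (v : M) (hv : QAct.IsHWVector n A ρ ψ v) (I : Ideal A)
    (hI : ∀ x : ↥(h0A n A), EntriesIn n A I ↑x → ψ x = 0)
    (x : ↥(qA n A)) (hx : InH1 n A x.1) (hxI : EntriesIn n A I x.1) : ρ.act x v = 0 := by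
  obtain ⟨hv0, -, hvn, hvh⟩ := hv
  have xe : evq n A x = 0 := Subtype.ext (Prod.ext hx.1 rfl)
  have xo : odq n A x = x := Subtype.ext (Prod.ext hx.1.symm rfl)
  have xs : sgq n A x = -x := by rw [sgq_eq, xe, xo, zero_sub]
  have xH : InH n A x.1 := ⟨by rw [hx.1]; exact Matrix.isDiag_zero, hx.2⟩
  let K : Submodule ℂ M :=
    { carrier := {w | (∀ z : ↥(qA n A), InNplus n A z.1 → ρ.act z w = 0) ∧
        (∀ (p : QPair n A) (hp : p ∈ h0A n A),
          ρ.act ⟨p, h0A_le_qA n A hp⟩ w = ψ ⟨p, hp⟩ • w) ∧ ρ.act x w = 0}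
      add_mem' := by
        rintro a b ⟨a1, a2, a3⟩ ⟨b1, b2, b3⟩
        refine ⟨fun z hz => ?_, fun p hp => ?_, ?_⟩
        · rw [map_add, a1 z hz, b1 z hz, add_zero]
        · rw [map_add, a2 p hp, b2 p hp, smul_add]
        · rw [map_add, a3, b3, add_zero]
      zero_mem' := by simp
      smul_mem' := by
        rintro c a ⟨a1, a2, a3⟩
        refine ⟨fun z hz => ?_, fun p hp => ?_, ?_⟩
        · rw [map_smul, a1 z hz, smul_zero]
        · rw [map_smul, a2 p hp, smul_comm]
        · rw [map_smul, a3, smul_zero] }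
  have hbr : ∀ (h : ↥(qA n A)), InH n A h.1 → ∀ w : M,
      (∀ (p : QPair n A) (hp : p ∈ h0A n A),
          ρ.act ⟨p, h0A_le_qA n A hp⟩ w = ψ ⟨p, hp⟩ • w) →
      ρ.act (brq n A x h) w = 0 := by
    intro h hh w hw
    have hm := br_h1_H n A x h hx hh
    have := hw _ hm
    rw [hI ⟨_, hm⟩ (br_entriesIn' n A I h x hxI), zero_smul] at this
    exact this
  have hxv : ρ.act x v ∈ K := by
    refine ⟨Np_H n A ρ hrep v hvn x xH, fun p hp => ?_, ?_⟩
    · rw [h0_H n A ρ hrep v _ x ⟨hp.1, hp.2.1⟩ xH, hvh p hp, map_smul]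
    · have := comm_formula n A ρ hrep x x v
      rw [hbr x xH v hvh, xe, xo, xs] at this
      simp only [map_zero, LinearMap.zero_apply, map_neg, LinearMap.neg_apply, zero_add,
        add_zero] at this
      have h2 : (2 : ℂ) • ρ.act x (ρ.act x v) = 0 := by
        rw [two_smul]; nth_rewrite 1 [this]; exact neg_add_cancel _
      exact (smul_eq_zero.1 h2).resolve_left two_ne_zero
  set c : ℂ := ψ ⟨_, dmat_mem n A⟩ with hc
  have hKe : ∀ w ∈ K, w ∈ Module.End.eigenspace (ρ.act (dq n A)) c := by
    intro w hw
    rw [Module.End.mem_eigenspace_iff]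
    exact hw.2.1 _ (dmat_mem n A)
  have hve : v ∈ Module.End.eigenspace (ρ.act (dq n A)) c := by
    rw [Module.End.mem_eigenspace_iff]
    exact hvh _ (dmat_mem n A)
  have hA : K = ⊥ ∨ K ⊔ Low n A ρ c = ⊤ := by
    refine lemA n A ρ hrep hirr K (Low n A ρ c) (fun z hz w hw => hw.1 z hz) ?_ ?_ ?_
      (fun z hz w hw => nm_low n A ρ hrep c z hz w hw)
    · rintro h hh w ⟨w1, w2, w3⟩
      refine ⟨Np_H n A ρ hrep w w1 h hh, fun p hp => ?_, ?_⟩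
      · rw [h0_H n A ρ hrep w _ h ⟨hp.1, hp.2.1⟩ hh, w2 p hp, map_smul]
      · rw [comm_formula n A ρ hrep, hbr h hh w w2, xe, xo, w3]
        simp
    · rintro w ⟨w1, w2, w3⟩
      refine ⟨fun z hz => ?_, fun p hp => ?_, ?_⟩
      · rw [P_formula n A ρ hrep, w1 _ (sg_Np n A z hz), map_zero]
      · rw [P_formula n A ρ hrep]
        have : sgq n A ⟨p, h0A_le_qA n A hp⟩ = ⟨p, h0A_le_qA n A hp⟩ :=
          Subtype.ext (Prod.ext rfl (by simp [sgq, hp.1]))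
        rw [this, w2 p hp, map_smul]
      · rw [P_formula n A ρ hrep, xs, map_neg, LinearMap.neg_apply, w3, neg_zero, map_zero]
    · intro z hz w hw
      refine nm_eig n A ρ hrep c 0 z hz w ?_
      have := hKe w hw
      simpa using this
  rcases hA with h | h
  · rw [h] at hxv
    simpa using hxv
  · have hvT : v ∈ K ⊔ Low n A ρ c := by rw [h]; trivial
    obtain ⟨a, ha, b, hb, hab⟩ := Submodule.mem_sup.1 hvT
    have hb' : b ∈ Module.End.eigenspace (ρ.act (dq n A)) c := by
      have : b = v - a := by rw [← hab]; abel
      rw [this]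
      exact Submodule.sub_mem _ hve (hKe a ha)
    have hb0 : b = 0 := (Submodule.disjoint_def.1 (low_disj n A ρ c)) b hb' hb
    have : v = a := by rw [← hab, hb0, add_zero]
    rw [this]
    exact ha.2.2

/-- singular vectors of lower weight vanish -/
lemma sing_zero (ρ : QAct n A M) (hrep : QAct.IsRep n A ρ) (hirr : QAct.Irred n A ρ)
    (c : ℂ) (v : M) (hv0 : v ≠ 0) (hve : v ∈ Module.End.eigenspace (ρ.act (dq n A)) c)
    (k : ℕ) (u : M) (hu : ∀ z : ↥(qA n A), InNplus n A z.1 → ρ.act z u = 0)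
    (hue : u ∈ Module.End.eigenspace (ρ.act (dq n A)) (c - ((k:ℂ) + 1))) : u = 0 := by
  let K : Submodule ℂ M :=
    { carrier := {w | (∀ z : ↥(qA n A), InNplus n A z.1 → ρ.act z w = 0) ∧
        w ∈ Module.End.eigenspace (ρ.act (dq n A)) (c - ((k:ℂ) + 1))}
      add_mem' := by
        rintro a b ⟨a1, a2⟩ ⟨b1, b2⟩
        refine ⟨fun z hz => ?_, Submodule.add_mem _ a2 b2⟩
        rw [map_add, a1 z hz, b1 z hz, add_zero]
      zero_mem' := ⟨by simp, Submodule.zero_mem _⟩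
      smul_mem' := by
        rintro r a ⟨a1, a2⟩
        refine ⟨fun z hz => ?_, Submodule.smul_mem _ _ a2⟩
        rw [map_smul, a1 z hz, smul_zero] }
  have huK : u ∈ K := ⟨hu, hue⟩
  have hKL : K ≤ Low n A ρ c := fun w hw => Submodule.mem_iSup_of_mem k hw.2
  have dH : InH0 n A (dq n A).1 := ⟨rfl, (dmat_mem n A).2.1⟩
  have hA : K = ⊥ ∨ K ⊔ Low n A ρ c = ⊤ := by
    refine lemA n A ρ hrep hirr K (Low n A ρ c) (fun z hz w hw => hw.1 z hz) ?_ ?_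
      (fun z hz w hw => nm_low n A ρ hrep c z hz w (hKL hw))
      (fun z hz w hw => nm_low n A ρ hrep c z hz w hw)
    · rintro h hh w ⟨w1, w2⟩
      refine ⟨Np_H n A ρ hrep w w1 h hh, ?_⟩
      rw [Module.End.mem_eigenspace_iff] at w2 ⊢
      rw [h0_H n A ρ hrep w _ h dH hh, w2, map_smul]
    · rintro w ⟨w1, w2⟩
      refine ⟨fun z hz => ?_, ?_⟩
      · rw [P_formula n A ρ hrep, w1 _ (sg_Np n A z hz), map_zero]
      · rw [Module.End.mem_eigenspace_iff] at w2 ⊢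
        have : sgq n A (dq n A) = dq n A := Subtype.ext (Prod.ext rfl (by simp [sgq, dq]))
        rw [P_formula n A ρ hrep, this, w2, map_smul]
  rcases hA with h | h
  · rw [h] at huK
    simpa using huK
  · exfalso
    rw [sup_eq_right.2 hKL] at h
    apply hv0
    exact (Submodule.disjoint_def.1 (low_disj n A ρ c)) v hve (by rw [h]; trivial)

lemma br_fil (r : ℕ) (z f : ↥(qA n A)) (hz : InNplus n A z.1)
    (hf : ∀ i j : Fin (n+1), (i:ℤ) - j ≠ (r:ℤ) + 1 → f.1.1 i j = 0 ∧ f.1.2 i j = 0) :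
    ∀ i j : Fin (n+1), (j:ℕ) + r < i → (brq n A z f).1.1 i j = 0 ∧ (brq n A z f).1.2 i j = 0 := by
  have l : ∀ X Y : QMat n A, (∀ i j, j ≤ i → X i j = 0) →
      (∀ i j : Fin (n+1), (i:ℤ) - j ≠ (r:ℤ) + 1 → Y i j = 0) →
      ∀ i j : Fin (n+1), (j:ℕ) + r < i → (X * Y) i j = 0 ∧ (Y * X) i j = 0 := by
    intro X Y hX hY i j hij
    rw [Matrix.mul_apply, Matrix.mul_apply]
    constructor
    · refine Finset.sum_eq_zero fun k _ => ?_
      by_cases h : k ≤ i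
      · rw [hX i k h, zero_mul]
      · rw [hY k j (by omega), mul_zero]
    · refine Finset.sum_eq_zero fun k _ => ?_
      by_cases h : j ≤ k
      · rw [hX k j h, mul_zero]
      · rw [hY i k (by omega), zero_mul]
  intro i j hij
  have z1 : ∀ i j, j ≤ i → z.1.1 i j = 0 := fun i j h => (hz i j h).1
  have z2 : ∀ i j, j ≤ i → z.1.2 i j = 0 := fun i j h => (hz i j h).2
  have f1 := fun i j h => (hf i j h).1
  have f2 := fun i j h => (hf i j h).2
  have ne : i ≠ j := by rintro rfl; omega
  constructor
  · simp [brq, qbr, l _ _ z1 f1 i j hij, l _ _ z2 f2 i j hij, Matrix.one_apply_ne ne]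
  · simp [brq, qbr, l _ _ z1 f2 i j hij, l _ _ z2 f1 i j hij]

lemma step2 (ρ : QAct n A M) (hrep : QAct.IsRep n A ρ) (hirr : QAct.Irred n A ρ)
    (ψ : ↥(h0A n A) →ₗ[ℂ] ℂ) (v : M) (hv : QAct.IsHWVector n A ρ ψ v) (I : Ideal A)
    (hI : ∀ x : ↥(h0A n A), EntriesIn n A I ↑x → ψ x = 0) (r : ℕ) :
    ∀ p : ↥(qA n A), EntriesIn n A I p.1 →
      (∀ i j : Fin (n+1), (j:ℕ) + r < i → p.1.1 i j = 0 ∧ p.1.2 i j = 0) → ρ.act p v = 0 := by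
  have hs1 := step1 n A ρ hrep hirr ψ v hv I hI
  obtain ⟨hv0, -, hvn, hvh⟩ := hv
  have hve : v ∈ Module.End.eigenspace (ρ.act (dq n A)) (ψ ⟨_, dmat_mem n A⟩) := by
    rw [Module.End.mem_eigenspace_iff]
    exact hvh _ (dmat_mem n A)
  induction r with
  | zero =>
    intro p hpI hp
    rw [tri_decomp n A p]
    have e0 : mkq n A (fun r => 0 < r) p = 0 := by
      apply Subtype.ext
      ext i j
      all_goals
        by_cases h : (0:ℤ) < (i:ℤ) - j
        · have h1 := mkq_entry1 n A (fun r => 0 < r) p i j h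
          have h2 := hp i j (by omega)
          first
            | exact h1.1.trans h2.1
            | exact h1.2.trans h2.2
        · have h1 := mkq_entry0 n A (fun r => 0 < r) p i j h
          first
            | exact h1.1
            | exact h1.2
    set q := mkq n A (fun r => r = 0) p with hq
    have hqH : InH n A q.1 := mk_zero n A p
    have hqI : EntriesIn n A I q.1 := mkq_entriesIn n A I _ p hpI
    have h1 : ρ.act (odq n A q) v = 0 :=
      hs1 _ ⟨rfl, hqH.2⟩ fun i j => ⟨I.zero_mem, (hqI i j).2⟩
    have h2 : ρ.act (evq n A q) v = 0 := by
      have hm : (evq n A q).1 ∈ h0A n A := ⟨rfl, hqH.1, q.2.1⟩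
      have := hvh _ hm
      rw [hI ⟨_, hm⟩ fun i j => ⟨(hqI i j).1, I.zero_mem⟩, zero_smul] at this
      exact this
    rw [e0, ← ev_add_od n A q]
    simp only [map_add, LinearMap.add_apply, map_zero, LinearMap.zero_apply, h1, h2,
      hvn _ (mk_neg n A p), add_zero]
  | succ r ih =>
    intro p hpI hp
    have dec : p = mkq n A (fun t => t < (r:ℤ) + 1) p + mkq n A (fun t => t = (r:ℤ) + 1) p := by
      apply Subtype.ext
      ext i j
      all_goals
        have := hp i j
        simp only [mkq, mk1, Submodule.coe_add, Prod.fst_add, Prod.snd_add, Matrix.add_apply,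
          Matrix.of_apply]
        rcases lt_trichotomy ((i:ℤ) - j) ((r:ℤ) + 1) with h | h | h
        · rw [if_pos h, if_neg h.ne, add_zero]
        · rw [if_neg (by omega), if_pos h, zero_add]
        · rw [if_neg (by omega), if_neg (by omega), add_zero]
          first
            | exact (this (by omega)).1
            | exact (this (by omega)).2
    rw [dec, map_add, LinearMap.add_apply]
    rw [ih _ (mkq_entriesIn n A I _ p hpI)
      (fun i j h => mkq_entry0 n A _ p i j (by omega)), zero_add]
    set f := mkq n A (fun t => t = (r:ℤ) + 1) p with hf
    have hf0 : ∀ i j : Fin (n+1), (i:ℤ) - j ≠ (r:ℤ) + 1 → f.1.1 i j = 0 ∧ f.1.2 i j = 0 :=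
      fun i j h => mkq_entry0 n A _ p i j h
    refine sing_zero n A ρ hrep hirr _ v hv0 hve r _ (fun z hz => ?_) ?_
    · rw [comm_formula n A ρ hrep, hvn _ (ev_Np n A z hz), hvn _ (od_Np n A z hz),
        ih _ (br_entriesIn n A I z f (mkq_entriesIn n A I _ p hpI)) (br_fil n A r z f hz hf0)]
      simp
    · have := eig_shift n A ρ hrep ((r:ℤ)+1) f hf0 _ v hve
      simpa using this

end Helpers

/-- For `ψ ∈ 𝓛(𝔥 ⊗ A)` and an ideal `I ⊆ A`: `ψ(𝔥₀ ⊗ I) = 0` if and only if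
`(𝔮 ⊗ I) V(ψ) = 0`.  Here `V(ψ)` is (any model of) the irreducible highest weight
`𝔮(n) ⊗ A`-module of highest weight `ψ`, i.e. any irreducible module with a highest
weight vector of weight `ψ`. -/
theorem psi_vanishes_iff_ideal_annihilates (hn : 2 ≤ n)
    (ρ : QAct n A M) (hrep : QAct.IsRep n A ρ) (hirr : QAct.Irred n A ρ)
    (ψ : ↥(h0A n A) →ₗ[ℂ] ℂ) (hψ : LFun n A ψ)
    (v : M) (hv : QAct.IsHWVector n A ρ ψ v)
    (I : Ideal A) :
    (∀ x : ↥(h0A n A), EntriesIn n A I ↑x → ψ x = 0) ↔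
      (∀ x : ↥(qA n A), EntriesIn n A I ↑x → ρ.act x = 0) := by
  constructor
  · intro hI
    have hWv : ∀ x : ↥(qA n A), EntriesIn n A I x.1 → ρ.act x v = 0 := fun x hx =>
      step2 n A ρ hrep hirr ψ v hv I hI n x hx fun i j h => by omega
    let W : Submodule ℂ M :=
      { carrier := {w | ∀ x : ↥(qA n A), EntriesIn n A I x.1 → ρ.act x w = 0}
        add_mem' := by
          intro a b ha hb x hx
          rw [map_add, ha x hx, hb x hx, add_zero]
        zero_mem' := by simp
        smul_mem' := by
          intro c a ha x hx
          rw [map_smul, ha x hx, smul_zero] }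
    have hW : QAct.Invt n A ρ W := by
      constructor
      · intro z w hw x hx
        rw [comm_formula n A ρ hrep, hw _ (br_entriesIn' n A I z x hx),
          hw (evq n A x) (fun i j => ⟨(hx i j).1, I.zero_mem⟩),
          hw (odq n A x) (fun i j => ⟨I.zero_mem, (hx i j).2⟩)]
        simp
      · intro w hw x hx
        rw [P_formula n A ρ hrep,
          hw (sgq n A x) (fun i j => ⟨(hx i j).1, I.neg_mem (hx i j).2⟩), map_zero]
    have hvW : v ∈ W := hWv
    rcases hirr.2 W hW with h | h
    · rw [h] at hvW
      exact absurd (by simpa using hvW) hv.1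
    · intro x hx
      ext w
      have : w ∈ W := by rw [h]; trivial
      exact this x hx
  · intro hact x hx
    have h := hv.2.2.2 x.1 x.2
    rw [hact _ hx] at h
    have h' : ψ x • v = 0 := by simpa using h.symm
    exact (smul_eq_zero.1 h').resolve_right hv.1
end
end
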